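/- arXiv:2209.09598 — 4 statements merged into one kernel-verified Lean document; each statement's English description precedes it below -/
import Mathlib

section
/- If w is an infinite binary word that is 7/3-free (i.e., every nonempty finite factor of w has exponent strictly less than 7/3), then w contains arbitrarily large complementary factors: for every natural number n there exists a finite binary word x with |x| ≥ n such that both x and its complement x̄ are factors of w. -/
/-- `x` occurs as a contiguous block in the infinite word `w : ℕ → α`. -/
def FactorN {α : Type*} (w : ℕ → α) (x : List α) : Prop :=
  ∃ i : ℕ, x = (List.range x.length).map fun k => w (i + k)

/-- the finite word `u` has period `p ≥ 1`. -/
def HasPeriod {α : Type*} (u : List α) (p : ℕ) : Prop :=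
  1 ≤ p ∧ ∀ i : ℕ, i + p < u.length → u[i]? = u[i + p]?

/-- the smallest period of `u`. -/
noncomputable def minPeriod {α : Type*} (u : List α) : ℕ :=
  sInf {p | HasPeriod u p}

/-- the exponent of `u`: its length divided by its smallest period. -/
noncomputable def expo {α : Type*} (u : List α) : ℝ :=
  (u.length : ℝ) / (minPeriod u : ℝ)

/-- the complement of a binary word: each letter is flipped. -/
def comp (x : List Bool) : List Bool := x.map fun b => !b

/-- No block of `w` of length at least `7 / 3 * p` has period `p`. -/
def SevenThirdsFree (w : ℕ → Bool) : Prop :=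
  ∀ p i L : ℕ, 1 ≤ p → 7 * p ≤ 3 * L → ∃ k, k + p < L ∧ w (i + k) ≠ w (i + k + p)

theorem sevenThirdsFree_of_expo_lt (w : ℕ → Bool)
    (hfree : ∀ x : List Bool, FactorN w x → x ≠ [] → expo x < 7 / 3) :
    SevenThirdsFree w := by
  intro p i L hp hL
  by_contra! hper
  set x : List Bool := (List.range L).map fun k => w (i + k) with hx
  have hlen : x.length = L := by simp [hx]
  have hxp : HasPeriod x p := by
    refine ⟨hp, fun k hk => ?_⟩
    rw [hlen] at hk
    have hkL : k < L := by omega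
    simpa [hx, hk, hkL, add_assoc] using hper k hk
  have hne : x ≠ [] := by
    rw [← List.length_pos_iff]
    omega
  have hlt := hfree x ⟨i, by rw [hlen]⟩ hne
  have hle : minPeriod x ≤ p := Nat.sInf_le hxp
  have hpos : 1 ≤ minPeriod x := (Nat.sInf_mem (s := {p | HasPeriod x p}) ⟨p, hxp⟩).1
  have hpos' : (0 : ℝ) < minPeriod x := by exact_mod_cast hpos
  rw [expo, div_lt_iff₀ hpos', hlen] at hlt
  have hle' : (minPeriod x : ℝ) ≤ p := by exact_mod_cast hle
  have hL' : (7 : ℝ) * p ≤ 3 * L := by exact_mod_cast hL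
  linarith

namespace SevenThirdsFree

variable {w : ℕ → Bool}

theorem eq_of_ne_of_ne {a b c : Bool} (hab : a ≠ b) (hbc : b ≠ c) : a = c :=
  (Bool.eq_not.2 hab).trans (Bool.eq_not.2 hbc.symm).symm

theorem no_cube (h : SevenThirdsFree w) (j : ℕ) (h₀ : w j = w (j + 1)) :
    w (j + 1) ≠ w (j + 2) := by
  intro h₁
  obtain ⟨k, hk, hne⟩ := h 1 j 3 le_rfl (by norm_num)
  have : k < 2 := by omega
  interval_cases k <;> exact hne ‹_›

/-- Among any four consecutive positions, one starts a block `aa`. -/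
theorem exists_repeat (h : SevenThirdsFree w) (j : ℕ) :
    w j = w (j + 1) ∨ w (j + 1) = w (j + 2) ∨ w (j + 2) = w (j + 3) ∨ w (j + 3) = w (j + 4) := by
  by_contra! hne
  obtain ⟨h₀, h₁, h₂, h₃⟩ := hne
  have e₀ := eq_of_ne_of_ne h₀ h₁
  have e₁ := eq_of_ne_of_ne h₁ h₂
  have e₂ := eq_of_ne_of_ne h₂ h₃
  obtain ⟨k, hk, hne⟩ := h 2 j 5 (by norm_num) (by norm_num)
  have : k < 3 := by omega
  interval_cases k <;> exact hne ‹_›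

/-- Away from the start of the word, no block `aabaa` with `a ≠ b` occurs. -/
theorem no_aabaa (h : SevenThirdsFree w) (j : ℕ) (h₀ : w (j + 1) = w (j + 2))
    (h₃ : w (j + 4) = w (j + 5)) : w (j + 3) = w (j + 4) := by
  by_contra h₂
  have hl : w j ≠ w (j + 1) := fun e => h.no_cube j e h₀
  have hm : w (j + 2) ≠ w (j + 3) := h.no_cube (j + 1) h₀
  have hr : w (j + 5) ≠ w (j + 6) := h.no_cube (j + 4) h₃
  have e₀ : w j = w (j + 3) := eq_of_ne_of_ne hl (h₀ ▸ hm)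
  have e₂ : w (j + 2) = w (j + 4) := eq_of_ne_of_ne hm h₂
  have e₃ : w (j + 3) = w (j + 6) := eq_of_ne_of_ne (h₃ ▸ h₂) hr
  have e₁ : w (j + 1) = w (j + 4) := h₀.trans e₂
  have e₄ : w (j + 2) = w (j + 5) := e₂.trans h₃
  obtain ⟨k, hk, hne⟩ := h 3 j 7 (by norm_num) (by norm_num)
  have : k < 4 := by omega
  interval_cases k <;> exact hne ‹_›

/-- From some position on, a `7/3`-free word is a product of blocks `01` and `10`. -/
theorem exists_parsing (h : SevenThirdsFree w) :
    ∃ i, ∀ k, w (i + 2 * k + 1) = !w (i + 2 * k) := by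
  obtain ⟨j, hj⟩ : ∃ j, w (j + 1) = w (j + 2) := by
    rcases h.exists_repeat 1 with e | e | e | e
    exacts [⟨0, e⟩, ⟨1, e⟩, ⟨2, e⟩, ⟨3, e⟩]
  have key : ∀ k, w (j + 2 * k + 2) ≠ w (j + 2 * k + 3) ∧
      (w (j + 2 * k + 1) = w (j + 2 * k + 2) ∨ w (j + 2 * k + 3) = w (j + 2 * k + 4)) := by
    intro k
    induction k with
    | zero => exact ⟨h.no_cube (j + 1) hj, Or.inl hj⟩
    | succ k ih =>
      rw [show j + 2 * (k + 1) = j + 2 * k + 2 by ring]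
      generalize j + 2 * k = m at ih ⊢
      simp only [add_assoc, Nat.reduceAdd]
      have hcube := h.no_cube (m + 3)
      have hrep := h.exists_repeat (m + 2)
      have hgap := h.no_aabaa m
      simp only [add_assoc, Nat.reduceAdd] at hcube hrep hgap
      grind
  refine ⟨j + 2, fun k => ?_⟩
  have := (key k).1
  rw [show j + 2 + 2 * k = j + 2 * k + 2 by ring]
  exact Bool.eq_not.2 this.symm

/-- Desubstituting the Thue-Morse morphism preserves `7/3`-freeness. -/
theorem desubstitute (h : SevenThirdsFree w) {i : ℕ}
    (hi : ∀ k, w (i + 2 * k + 1) = !w (i + 2 * k)) :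
    SevenThirdsFree fun k => w (i + 2 * k) := by
  intro p j L hp hL
  obtain ⟨k, hk, hne⟩ := h (2 * p) (i + 2 * j) (2 * L) (by omega) (by omega)
  refine ⟨k / 2, by omega, fun e => hne ?_⟩
  rcases Nat.even_or_odd' k with ⟨c, rfl | rfl⟩
  · rw [Nat.mul_div_cancel_left c two_pos] at e
    convert e using 2 <;> ring
  · rw [show (2 * c + 1) / 2 = c by omega] at e
    have h₁ := hi (j + c)
    have h₂ := hi (j + c + p)
    dsimp only at e
    rw [e, ← h₂] at h₁
    convert h₁ using 2 <;> ring

/-- Two blocks of length `2 ^ n` are complementary. -/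
theorem exists_complementary (n : ℕ) : ∀ {w : ℕ → Bool}, SevenThirdsFree w →
    ∃ a b, ∀ k < 2 ^ n, w (b + k) = !w (a + k) := by
  induction n with
  | zero =>
    intro w h
    obtain ⟨i, hi⟩ := h.exists_parsing
    exact ⟨i, i + 1, by simpa using hi 0⟩
  | succ n ih =>
    intro w h
    obtain ⟨i, hi⟩ := h.exists_parsing
    obtain ⟨a, b, hab⟩ := ih (h.desubstitute hi)
    refine ⟨i + 2 * a, i + 2 * b, fun k hk => ?_⟩
    rw [pow_succ] at hk
    rcases Nat.even_or_odd' k with ⟨c, rfl | rfl⟩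
    · convert hab c (by omega) using 2
      · ring
      · congr 1; ring
    · have e := hab c (by omega)
      have ha := hi (a + c)
      have hb := hi (b + c)
      rw [e, ← ha] at hb
      convert hb using 2
      · ring
      · congr 1; ring

end SevenThirdsFree

theorem stmt0 (w : ℕ → Bool)
    (hfree : ∀ x : List Bool, FactorN w x → x ≠ [] → expo x < 7 / 3) :
    ∀ n : ℕ, ∃ x : List Bool, n ≤ x.length ∧ FactorN w x ∧ FactorN w (comp x) := by
  intro n
  obtain ⟨a, b, hab⟩ :=
    SevenThirdsFree.exists_complementary n (sevenThirdsFree_of_expo_lt w hfree)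
  refine ⟨(List.range (2 ^ n)).map fun k => w (a + k), ?_, ⟨a, by simp⟩, ⟨b, ?_⟩⟩
  · simpa using Nat.lt_two_pow_self.le
  · simp only [comp, List.length_map, List.length_range, List.map_map]
    refine List.map_congr_left fun k hk => ?_
    simpa using (hab k (List.mem_range.1 hk)).symm
end

section
/- There exists an infinite binary word w that is (2+α)⁺-free, where α = (1+√5)/2 is the golden ratio, such that there is no binary word x with |x| ≥ 3 for which both x and its complement x̄ are factors of w. -/
open Real goldenRatio

namespace GoldenWord

/-- The rotation length `2 + φ`: the ones of the word sit at the positions `⌈l (2 + φ)⌉`. -/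
noncomputable def rot : ℝ := 2 + φ

/-- `k` is at distance less than one to the right of a multiple of `rot`. -/
def Marked (k : ℤ) : Prop := ∃ l : ℤ, 0 ≤ (k : ℝ) - l * rot ∧ (k : ℝ) - l * rot < 1

/-- The Sturmian word marking the integers `⌈l (2 + φ)⌉`. -/
noncomputable def word (n : ℕ) : Bool := by
  classical exact decide (Marked n)

/-- The denominators `1, 3, 4, 7, 11, …` of the convergents of `1 / rot`. -/
def denom (n : ℕ) : ℤ := 2 * Nat.fib n + Nat.fib (n + 1)

lemma word_eq_true {n : ℕ} : word n = true ↔ Marked n := by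
  simp [word]

lemma word_eq_iff {m n : ℕ} : word m = word n ↔ (Marked m ↔ Marked n) := by
  rw [Bool.eq_iff_iff, word_eq_true, word_eq_true]

lemma goldenConj_bounds : -0.62 < ψ ∧ ψ < -0.61 := by
  have h : ψ ^ 2 = ψ + 1 := goldenConj_sq
  have h0 := goldenConj_neg
  constructor <;> nlinarith

lemma rot_bounds : 3.61 < rot ∧ rot < 3.62 := by
  have h := goldenConj_bounds
  have h' := goldenRatio_add_goldenConj
  unfold rot
  constructor <;> linarith

lemma not_marked {k l : ℤ} (h1 : 1 ≤ (k : ℝ) - l * rot) (h2 : (k : ℝ) - l * rot < rot) :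
    ¬ Marked k := by
  rintro ⟨l', h3, h4⟩
  have ht := rot_bounds
  have hl : l < l' + 1 := by
    have : (l : ℝ) < l' + 1 := by nlinarith
    exact_mod_cast this
  have hl' : l' < l + 1 := by
    have : (l' : ℝ) < l + 1 := by nlinarith
    exact_mod_cast this
  obtain rfl : l = l' := by omega
  linarith

lemma denom_add_two (n : ℕ) : denom (n + 2) = denom n + denom (n + 1) := by
  simp only [denom, Nat.fib_add_two]
  push_cast
  ring

lemma denom_pos (n : ℕ) : 0 < denom n := by
  have : 0 < Nat.fib (n + 1) := Nat.fib_pos.2 n.succ_pos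
  unfold denom
  omega

lemma lt_denom (n : ℕ) : (n : ℤ) < denom n := by
  induction n using Nat.twoStepInduction with
  | zero => simp [denom]
  | one => simp [denom]
  | more n h1 h2 =>
    have := denom_pos n
    rw [denom_add_two]
    push_cast at *
    omega

lemma denom_sub_fib_mul_rot (n : ℕ) : (denom n : ℝ) - (Nat.fib n : ℤ) * rot = ψ ^ n := by
  rw [← fib_succ_sub_goldenRatio_mul_fib]
  simp only [denom, rot]
  push_cast
  ring

lemma exists_convergent_coordinates (n : ℕ) (k l : ℤ) : ∃ a b : ℤ,
    k = a * denom n + b * denom (n + 1) ∧ l = a * Nat.fib n + b * Nat.fib (n + 1) := by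
  induction n with
  | zero => exact ⟨k - 3 * l, l, by simp [denom]; ring, by simp⟩
  | succ n ih =>
    obtain ⟨a, b, hk, hl⟩ := ih
    refine ⟨b - a, a, ?_, ?_⟩
    · rw [hk, denom_add_two]
      ring
    · rw [hl, Nat.fib_add_two]
      push_cast
      ring

/-- Convergents are best approximations. -/
lemma abs_goldenConj_pow_le {n : ℕ} {p : ℤ} (hp : 0 < p) (hpn : p < denom (n + 1)) (l : ℤ) :
    |ψ ^ n| ≤ |(p : ℝ) - l * rot| := by
  obtain ⟨a, b, hk, hl⟩ := exists_convergent_coordinates n p l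
  have h1 := denom_sub_fib_mul_rot n
  have h2 := denom_sub_fib_mul_rot (n + 1)
  have hv : (p : ℝ) - l * rot = ψ ^ n * (a + b * ψ) := by
    rw [hk, hl]
    push_cast at *
    rw [pow_succ] at h2
    linear_combination (a : ℝ) * h1 + (b : ℝ) * h2
  have hq := denom_pos n
  have hq' := denom_pos (n + 1)
  have hψ := goldenConj_bounds
  rw [hv, abs_mul]
  refine le_mul_of_one_le_right (abs_nonneg _) ?_
  rcases lt_trichotomy b 0 with hb | rfl | hb
  · have ha : 1 ≤ a := by
      by_contra! h
      nlinarith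
    have ha' : (1 : ℝ) ≤ a := by exact_mod_cast ha
    have hb' : (b : ℝ) < 0 := by exact_mod_cast hb
    exact le_trans (by nlinarith) (le_abs_self _)
  · have ha : 1 ≤ a := by
      by_contra! h
      nlinarith
    have ha' : (1 : ℝ) ≤ a := by exact_mod_cast ha
    exact le_trans (by simpa using ha') (le_abs_self _)
  · have ha : a ≤ -1 := by
      by_contra! h
      nlinarith
    have ha' : (a : ℝ) ≤ -1 := by exact_mod_cast ha
    have hb' : (0 : ℝ) < b := by exact_mod_cast hb
    exact le_trans (by nlinarith) (neg_le_abs _)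

/-- Any `denom n + denom (n + 1)` consecutive points of the rotation meet every half-open window
of length `|ψ ^ n|`. -/
lemma exists_mem_window (n : ℕ) (s : ℝ) (A : ℤ) : ∃ k l : ℤ,
    A ≤ k ∧ k < A + (denom n + denom (n + 1)) ∧
      s ≤ (k : ℝ) - l * rot ∧ (k : ℝ) - l * rot < s + |ψ ^ n| := by
  have h1 := denom_sub_fib_mul_rot n
  have h2 := denom_sub_fib_mul_rot (n + 1)
  have hq := denom_pos n
  have hq' := denom_pos (n + 1)
  have hψ := goldenConj_bounds
  rw [pow_succ] at h2
  have hne : ψ ^ n ≠ 0 := pow_ne_zero _ goldenConj_ne_zero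
  set e := ψ ^ n
  set S : ℤ → Prop := fun k => ∃ l : ℤ, s ≤ (k : ℝ) - l * rot ∧ (k : ℝ) - l * rot < s + |e|
  have step : ∀ v : ℝ, s ≤ v → v < s + |e| →
      ((s ≤ v + e * ψ ∧ v + e * ψ < s + |e|) ∨
        (s ≤ v + (e + e * ψ) ∧ v + (e + e * ψ) < s + |e|)) ∧
      ((s ≤ v - e * ψ ∧ v - e * ψ < s + |e|) ∨
        (s ≤ v - (e + e * ψ) ∧ v - (e + e * ψ) < s + |e|)) := by
    intro v hv1 hv2
    rcases lt_or_gt_of_ne hne with he | he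
    · rw [abs_of_neg he] at *
      have h3 : 0 < e * ψ := by nlinarith
      have h4 : e * ψ < -e := by nlinarith
      constructor
      · by_cases h : v + e * ψ < s + -e
        · left; constructor <;> linarith
        · right; constructor <;> linarith
      · by_cases h : s ≤ v - e * ψ
        · left; constructor <;> linarith
        · right; constructor <;> linarith
    · rw [abs_of_pos he] at *
      have h3 : e * ψ < 0 := by nlinarith
      have h4 : -e < e * ψ := by nlinarith
      constructor
      · by_cases h : s ≤ v + e * ψ
        · left; constructor <;> linarith
        · right; constructor <;> linarith
      · by_cases h : v - e * ψ < s + e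
        · left; constructor <;> linarith
        · right; constructor <;> linarith
  have e1 : ∀ k l : ℤ, ((k + denom (n + 1) : ℤ) : ℝ) - (l + Nat.fib (n + 1) : ℤ) * rot =
      (k : ℝ) - l * rot + e * ψ := by
    intro k l
    push_cast at *
    linear_combination h2
  have e2 : ∀ k l : ℤ, ((k + (denom n + denom (n + 1)) : ℤ) : ℝ) -
      (l + (Nat.fib n + Nat.fib (n + 1)) : ℤ) * rot = (k : ℝ) - l * rot + (e + e * ψ) := by
    intro k l
    push_cast at *
    linear_combination h1 + h2
  have e3 : ∀ k l : ℤ, ((k - denom (n + 1) : ℤ) : ℝ) - (l - Nat.fib (n + 1) : ℤ) * rot =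
      (k : ℝ) - l * rot - e * ψ := by
    intro k l
    push_cast at *
    linear_combination -h2
  have e4 : ∀ k l : ℤ, ((k - (denom n + denom (n + 1)) : ℤ) : ℝ) -
      (l - (Nat.fib n + Nat.fib (n + 1)) : ℤ) * rot = (k : ℝ) - l * rot - (e + e * ψ) := by
    intro k l
    push_cast at *
    linear_combination -h1 - h2
  have forward : ∀ k, S k → ∃ k', S k' ∧ k < k' := by
    rintro k ⟨l, hl1, hl2⟩
    rcases (step _ hl1 hl2).1 with h | h
    · exact ⟨_, ⟨_, by rw [e1]; exact h⟩, by omega⟩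
    · exact ⟨_, ⟨_, by rw [e2]; exact h⟩, by omega⟩
  have backward : ∀ k, S k → ∃ k', S k' ∧ k - (denom n + denom (n + 1)) ≤ k' ∧ k' < k := by
    rintro k ⟨l, hl1, hl2⟩
    rcases (step _ hl1 hl2).2 with h | h
    · exact ⟨_, ⟨_, by rw [e3]; exact h⟩, by omega, by omega⟩
    · exact ⟨_, ⟨_, by rw [e4]; exact h⟩, by omega, by omega⟩
  have inhabited : ∃ k, S k := by
    have hpos : 0 < |e| := abs_pos.2 hne
    have c1 : s ≤ ⌈s / |e|⌉ * |e| := (div_le_iff₀ hpos).1 (Int.le_ceil _)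
    have c2 : ⌈s / |e|⌉ * |e| < s + |e| := by
      have := Int.ceil_lt_add_one (s / |e|)
      have := mul_lt_mul_of_pos_right this hpos
      rwa [add_mul, div_mul_cancel₀ _ hpos.ne', one_mul] at this
    generalize ⌈s / |e|⌉ = a at c1 c2
    have key : ∀ a : ℤ, ((a * denom n : ℤ) : ℝ) - (a * Nat.fib n : ℤ) * rot = a * e := by
      intro a
      push_cast at *
      linear_combination (a : ℝ) * h1
    rcases abs_choice e with h | h
    · exact ⟨a * denom n, a * Nat.fib n, by rw [key, ← h, abs_abs]; exact ⟨c1, c2⟩⟩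
    · refine ⟨(-a) * denom n, (-a) * Nat.fib n, ?_⟩
      have : ((-a : ℤ) : ℝ) * e = a * |e| := by
        rw [h]
        push_cast
        ring
      rw [key, this]
      exact ⟨c1, c2⟩
  have above : ∃ k, A ≤ k ∧ S k := by
    by_contra! h
    obtain ⟨k, hk, hmax⟩ := Int.exists_greatest_of_bdd (P := S)
      ⟨A, fun z hz => by
        by_contra! hlt
        exact h z hlt.le hz⟩ inhabited
    obtain ⟨k', hk', hlt⟩ := forward k hk
    exact absurd (hmax k' hk') (by omega)
  obtain ⟨k, ⟨hAk, hk⟩, hmin⟩ := Int.exists_least_of_bdd (P := fun k => A ≤ k ∧ S k)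
    ⟨A, fun z hz => hz.1⟩ above
  obtain ⟨k', hk', h5, h6⟩ := backward k hk
  have hk'A : k' < A := by
    by_contra! hle
    exact absurd (hmin k' ⟨hle, hk'⟩) (by omega)
  obtain ⟨l, hl1, hl2⟩ := hk
  exact ⟨k, l, hAk, by omega, hl1, hl2⟩

/-- Both translates by `0` and `1` of a window of length `|ψ ^ n|` consist of points whose mark
changes under translation by `p`. -/
lemma exists_mismatch_window {n : ℕ} {p l : ℤ} (hlow : |ψ ^ n| ≤ |(p : ℝ) - l * rot|)
    (hhigh : |(p : ℝ) - l * rot| ≤ 1) : ∃ s : ℝ, ∀ k j : ℤ, s ≤ (k : ℝ) - j * rot →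
      (k : ℝ) - j * rot < s + |ψ ^ n| →
        ¬ (Marked k ↔ Marked (k + p)) ∧ ¬ (Marked (k + 1) ↔ Marked (k + 1 + p)) := by
  have ht := rot_bounds
  have shift : ∀ k j : ℤ, ((k + p : ℤ) : ℝ) - (j + l : ℤ) * rot =
      ((k : ℝ) - j * rot) + ((p : ℝ) - l * rot) := by
    intro k j
    push_cast
    ring
  have shift1 : ∀ k j : ℤ, ((k + 1 : ℤ) : ℝ) - j * rot = ((k : ℝ) - j * rot) + 1 := by
    intro k j
    push_cast
    ring
  have back : ∀ k j : ℤ, (k : ℝ) - (j - 1 : ℤ) * rot = ((k : ℝ) - j * rot) + rot := by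
    intro k j
    push_cast
    ring
  set d := (p : ℝ) - l * rot
  rcases le_or_gt 0 d with hd | hd
  · rw [abs_of_nonneg hd] at *
    refine ⟨-|ψ ^ n|, fun k j h1 h2 => ⟨fun h => ?_, fun h => ?_⟩⟩
    · refine not_marked (k := k) (l := j - 1) ?_ ?_ (h.2 ⟨j + l, ?_, ?_⟩)
      · rw [back]; linarith
      · rw [back]; linarith
      · rw [shift]; linarith
      · rw [shift]; linarith
    · refine not_marked (k := k + 1 + p) (l := j + l) ?_ ?_ (h.1 ⟨j, ?_, ?_⟩)
      · rw [shift, shift1]; linarith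
      · rw [shift, shift1]; linarith
      · rw [shift1]; linarith
      · rw [shift1]; linarith
  · rw [abs_of_neg hd] at *
    refine ⟨0, fun k j h1 h2 => ⟨fun h => ?_, fun h => ?_⟩⟩
    · refine not_marked (k := k + p) (l := j + l - 1) ?_ ?_ (h.1 ⟨j, ?_, ?_⟩)
      · rw [back, shift]; linarith
      · rw [back, shift]; linarith
      · linarith
      · linarith
    · refine not_marked (k := k + 1) (l := j) ?_ ?_ (h.2 ⟨j + l, ?_, ?_⟩)
      · rw [shift1]; linarith
      · rw [shift1]; linarith
      · rw [shift, shift1]; linarith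
      · rw [shift, shift1]; linarith

/-- A translation by more than one unit of the circle unmarks every marked point. -/
lemma not_marked_add {k p l : ℤ} (h1 : 1 < |(p : ℝ) - l * rot|)
    (h2 : |(p : ℝ) - l * rot| ≤ rot / 2) (hk : Marked k) : ¬ Marked (k + p) := by
  have ht := rot_bounds
  obtain ⟨j, hj1, hj2⟩ := hk
  rcases le_or_gt 0 ((p : ℝ) - l * rot) with hd | hd
  · rw [abs_of_nonneg hd] at *
    apply not_marked (l := j + l) <;> push_cast <;> linarith
  · rw [abs_of_neg hd] at *
    apply not_marked (l := j + l - 1) <;> push_cast <;> linarith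

lemma exists_abs_sub_le (p : ℤ) : ∃ l : ℤ, |(p : ℝ) - l * rot| ≤ rot / 2 := by
  have ht := rot_bounds
  have hpos : 0 < rot := by linarith
  refine ⟨round (p / rot), ?_⟩
  have h := abs_sub_round ((p : ℝ) / rot)
  have h' : (p : ℝ) - round (p / rot) * rot = (p / rot - round (p / rot)) * rot := by
    field_simp
  rw [h', abs_mul, abs_of_pos hpos]
  nlinarith

lemma exists_denom_le_lt {p : ℤ} (hp : 1 ≤ p) : ∃ n, denom n ≤ p ∧ p < denom (n + 1) := by
  classical
  have hex : ∃ n, p < denom n := ⟨p.toNat, by have := lt_denom p.toNat; omega⟩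
  have hspec := Nat.find_spec hex
  have hmin := fun m => Nat.find_min hex (m := m)
  generalize Nat.find hex = N at hspec hmin
  cases N with
  | zero => simp [denom] at hspec; omega
  | succ n => exact ⟨n, not_lt.1 (hmin n n.lt_succ_self), hspec⟩

lemma denom_succ_le (n : ℕ) : (denom (n + 1) : ℝ) - 2 ≤ φ * denom n := by
  have hψ := goldenConj_bounds
  have h0 := fib_succ_sub_goldenRatio_mul_fib n
  have h1 := fib_succ_sub_goldenRatio_mul_fib (n + 1)
  have habs : |ψ ^ n| ≤ 1 := by
    rw [abs_pow]
    exact pow_le_one₀ (abs_nonneg _) (abs_le.2 ⟨by linarith, by linarith⟩)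
  have hle := (abs_le.1 habs).2
  have hexp : (denom (n + 1) : ℝ) - φ * denom n = ψ ^ n * (2 + ψ) := by
    simp only [denom]
    rw [pow_succ] at h1
    push_cast
    linear_combination 2 * h0 + h1
  nlinarith

/-- A run of `m` agreements of the word with its translate by `p` is at most `(1 + φ) p` long. -/
lemma run_le {A p m : ℕ} (hp : 1 ≤ p) (h : ∀ i < m, word (A + i) = word (A + i + p)) :
    (m : ℝ) ≤ (1 + φ) * p := by
  have ht := rot_bounds
  have hφ : 1.61 < φ := by
    unfold rot at ht
    linarith
  have hmatch : ∀ k : ℤ, (A : ℤ) ≤ k → k < A + m → (Marked k ↔ Marked (k + p)) := by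
    intro k h1 h2
    have := word_eq_iff.1 (h (k - A).toNat (by omega))
    push_cast at this
    rwa [show (A : ℤ) + (k - A).toNat = k by omega] at this
  obtain ⟨l, hl⟩ := exists_abs_sub_le p
  obtain ⟨n, hn1, hn2⟩ := exists_denom_le_lt (p := p) (by omega)
  have hlow := abs_goldenConj_pow_le (n := n) (p := p) (by omega) hn2 l
  rcases le_or_gt |((p : ℤ) : ℝ) - l * rot| 1 with hd | hd
  · obtain ⟨s, hs⟩ := exists_mismatch_window hlow hd
    have hm : (m : ℤ) + 2 ≤ denom n + denom (n + 1) := by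
      by_contra! hlt
      obtain ⟨k, j, hk1, hk2, hk3, hk4⟩ := exists_mem_window n s (A - 1)
      obtain ⟨w1, w2⟩ := hs k j hk3 hk4
      rcases hk1.eq_or_lt with heq | hlt'
      · have := denom_pos n
        have := lt_denom (n + 1)
        push_cast at this
        exact w2 (hmatch (k + 1) (by omega) (by omega))
      · exact w1 (hmatch k (by omega) (by omega))
    have hm' : (m : ℝ) + 2 ≤ denom n + denom (n + 1) := by exact_mod_cast hm
    have hn' : (denom n : ℝ) ≤ p := by exact_mod_cast hn1
    have := denom_succ_le n
    nlinarith
  · have hm : m ≤ 3 := by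
      by_contra! hlt
      obtain ⟨k, j, hk1, hk2, hk3, hk4⟩ := exists_mem_window 0 0 A
      have hQ : denom 0 + denom (0 + 1) = 4 := by simp [denom]
      have hk : Marked k := ⟨j, hk3, by simpa using hk4⟩
      exact not_marked_add hd hl hk ((hmatch k hk1 (by omega)).1 hk)
    have hp2 : 2 ≤ p := by
      by_contra! hlt
      obtain rfl : p = 1 := by omega
      push_cast at hd hl
      rw [abs_le] at hl
      rcases lt_trichotomy l 0 with h0 | rfl | h0
      · have : (l : ℝ) ≤ -1 := by exact_mod_cast (by omega : l ≤ -1)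
        nlinarith
      · norm_num at hd
      · have : (1 : ℝ) ≤ l := by exact_mod_cast h0
        nlinarith
    have hm' : (m : ℝ) ≤ 3 := by exact_mod_cast hm
    have hp' : (2 : ℝ) ≤ p := by exact_mod_cast hp2
    nlinarith

lemma three_le_sub_of_marked {i j : ℤ} (hij : i < j) (hi : Marked i) (hj : Marked j) :
    i + 3 ≤ j := by
  have ht := rot_bounds
  obtain ⟨l, h1, h2⟩ := hi
  obtain ⟨l', h3, h4⟩ := hj
  have hij' : (i : ℝ) + 1 ≤ j := by exact_mod_cast hij
  have hl : l < l' := by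
    have : (l : ℝ) < l' := by nlinarith
    exact_mod_cast this
  have hl' : (l : ℝ) + 1 ≤ l' := by exact_mod_cast hl
  have : (i : ℝ) + 2 < j := by nlinarith
  have : i + 2 < j := by exact_mod_cast this
  omega

lemma word_eq_false_of_lt {i j : ℕ} (hij : i < j) (hj : j < i + 3) (h : word i = true) :
    word j = false := by
  by_contra hne
  rw [Bool.not_eq_false] at hne
  have := three_le_sub_of_marked (by omega) (word_eq_true.1 h) (word_eq_true.1 hne)
  omega

lemma getElem?_of_factor {α : Type*} {w : ℕ → α} {x : List α} {i : ℕ}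
    (h : x = (List.range x.length).map fun k => w (i + k)) {k : ℕ} (hk : k < x.length) :
    x[k]? = some (w (i + k)) := by
  rw [h]
  simp [hk]

lemma hasPeriod_minPeriod {α : Type*} {x : List α} (hx : x ≠ []) : HasPeriod x (minPeriod x) :=
  Nat.sInf_mem (s := {p | HasPeriod x p})
    ⟨x.length, List.length_pos_iff.2 hx, fun i hi => absurd hi (by omega)⟩

lemma expo_le {x : List Bool} (hf : FactorN word x) (hx : x ≠ []) : expo x ≤ 2 + φ := by
  obtain ⟨hp, hper⟩ := hasPeriod_minPeriod hx
  obtain ⟨A, hA⟩ := hf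
  unfold expo
  generalize minPeriod x = p at hp hper
  have hrun := run_le (A := A) (m := x.length - p) hp fun i hi => by
    have := hper i (by omega)
    rw [getElem?_of_factor hA (by omega), getElem?_of_factor hA (by omega)] at this
    simpa [add_assoc] using this
  have hp' : (1 : ℝ) ≤ p := by exact_mod_cast hp
  have hlen : (x.length : ℝ) ≤ (x.length - p : ℕ) + p := by
    exact_mod_cast (by omega : x.length ≤ x.length - p + p)
  rw [div_le_iff₀ (by linarith)]
  linarith

lemma not_factor_comp {x : List Bool} (hx : 3 ≤ x.length) :
    ¬ (FactorN word x ∧ FactorN word (comp x)) := by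
  rintro ⟨⟨i, hi⟩, ⟨j, hj⟩⟩
  have hcompl : ∀ k < 3, word (j + k) = !word (i + k) := by
    intro k hk
    have h1 := getElem?_of_factor hi (k := k) (by omega)
    have h2 := getElem?_of_factor hj (k := k) (by simp [comp]; omega)
    simpa [comp, h1, eq_comm] using h2
  have h0 := hcompl 0 (by omega)
  have h1 := hcompl 1 (by omega)
  have h2 := hcompl 2 (by omega)
  have i01 := word_eq_false_of_lt (i := i + 0) (j := i + 1) (by omega) (by omega)
  have i02 := word_eq_false_of_lt (i := i + 0) (j := i + 2) (by omega) (by omega)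
  have i12 := word_eq_false_of_lt (i := i + 1) (j := i + 2) (by omega) (by omega)
  have j01 := word_eq_false_of_lt (i := j + 0) (j := j + 1) (by omega) (by omega)
  have j02 := word_eq_false_of_lt (i := j + 0) (j := j + 2) (by omega) (by omega)
  have j12 := word_eq_false_of_lt (i := j + 1) (j := j + 2) (by omega) (by omega)
  rw [h0, h1] at j01
  rw [h0, h2] at j02
  rw [h1, h2] at j12
  clear hcompl h0 h1 h2 hi hj
  generalize word (i + 0) = a at *
  generalize word (i + 1) = b at *
  generalize word (i + 2) = c at *
  cases a <;> cases b <;> cases c <;> simp_all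

end GoldenWord

theorem stmt1 :
    ∃ w : ℕ → Bool,
      (∀ x : List Bool, FactorN w x → x ≠ [] → expo x ≤ 2 + (1 + Real.sqrt 5) / 2) ∧
      (∀ x : List Bool, 3 ≤ x.length → ¬(FactorN w x ∧ FactorN w (comp x))) :=
  ⟨GoldenWord.word, fun _ hf hx => GoldenWord.expo_le hf hx,
    fun _ hx => GoldenWord.not_factor_comp hx⟩
end

section
/- There exists an infinite binary word w that is 3⁺-free such that there is no binary word x with |x| ≥ 5 for which both x and its complement x̄ are factors of w. -/
/-- The Thue–Morse word: the parity of the number of ones in the binary expansion of `n`. -/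
def thueMorse : ℕ → Bool
  | 0 => false
  | n + 1 => xor (thueMorse ((n + 1) / 2)) (decide ((n + 1) % 2 = 1))

theorem thueMorse_two_mul (n : ℕ) : thueMorse (2 * n) = thueMorse n := by
  rcases n with _ | n
  · rfl
  · rw [show 2 * (n + 1) = (2 * n + 1) + 1 by ring, thueMorse,
      show (2 * n + 1 + 1) / 2 = n + 1 by omega, show (2 * n + 1 + 1) % 2 = 0 by omega]
    simp

theorem thueMorse_two_mul_add_one (n : ℕ) : thueMorse (2 * n + 1) = !thueMorse n := by
  rw [thueMorse, show (2 * n + 1) / 2 = n by omega, show (2 * n + 1) % 2 = 1 by omega]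
  simp

theorem thueMorse_succ_ne_of_even {m : ℕ} (hm : m % 2 = 0) :
    thueMorse m ≠ thueMorse (m + 1) := by
  obtain ⟨n, rfl⟩ : ∃ n, m = 2 * n := ⟨m / 2, by omega⟩
  rw [thueMorse_two_mul, thueMorse_two_mul_add_one]
  simp

/-- The Thue–Morse word has no cube of a letter. -/
theorem thueMorse_not_three_equal (n : ℕ) :
    ¬(thueMorse n = thueMorse (n + 1) ∧ thueMorse (n + 1) = thueMorse (n + 2)) := by
  rintro ⟨h₁, h₂⟩
  rcases Nat.mod_two_eq_zero_or_one n with h | h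
  · exact thueMorse_succ_ne_of_even h h₁
  · exact thueMorse_succ_ne_of_even (m := n + 1) (by omega) h₂

/-- Restricting the Thue–Morse word to positions of equal parity gives the word back,
up to complementation. -/
theorem thueMorse_eq_iff_of_parity {s : ℕ} (hs : s < 2) (a b : ℕ) :
    thueMorse (2 * a + s) = thueMorse (2 * b + s) ↔ thueMorse a = thueMorse b := by
  interval_cases s
  · simp [thueMorse_two_mul]
  · simp [thueMorse_two_mul_add_one]

theorem Bool.eq_of_ne_of_ne {a b c : Bool} (h₁ : a ≠ b) (h₂ : b ≠ c) : a = c := by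
  revert a b c
  decide

/-- The Thue–Morse word is overlap-free. -/
theorem thueMorse_overlap_free (q : ℕ) (hq : 1 ≤ q) (i : ℕ) :
    ¬∀ j ≤ q, thueMorse (i + j) = thueMorse (i + j + q) := by
  induction q using Nat.strong_induction_on generalizing i with
  | _ q ih =>
  intro h
  obtain ⟨a, s, hs, rfl⟩ : ∃ a s, s < 2 ∧ i = 2 * a + s :=
    ⟨i / 2, i % 2, by omega, by omega⟩
  rcases Nat.mod_two_eq_zero_or_one q with hpar | hpar
  · obtain ⟨r, rfl⟩ : ∃ r, q = 2 * r := ⟨q / 2, by omega⟩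
    refine ih r (by omega) (by omega) a fun j hj => ?_
    have := h (2 * j) (by omega)
    rwa [show 2 * a + s + 2 * j = 2 * (a + j) + s by ring,
      show 2 * (a + j) + s + 2 * r = 2 * (a + j + r) + s by ring,
      thueMorse_eq_iff_of_parity hs] at this
  · have h₀ := h 0 (by omega)
    have h₁ := h 1 (by omega)
    obtain rfl | hq3 : q = 1 ∨ 3 ≤ q := by omega
    · exact thueMorse_not_three_equal _ ⟨h₀, h₁⟩
    have alternating : ∀ j < q, thueMorse (2 * a + s + j) ≠ thueMorse (2 * a + s + j + 1) := by
      intro j hj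
      rcases Nat.mod_two_eq_zero_or_one (2 * a + s + j) with hm | hm
      · exact thueMorse_succ_ne_of_even hm
      · have e₁ := h j (by omega)
        have e₂ := h (j + 1) (by omega)
        have := thueMorse_succ_ne_of_even (m := 2 * a + s + j + q) (by omega)
        rw [show 2 * a + s + (j + 1) + q = 2 * a + s + j + q + 1 by ring] at e₂
        rwa [← e₁, ← e₂] at this
    have d₀ := alternating 0 (by omega)
    have d₁ := alternating 1 (by omega)
    have d₂ := alternating 2 (by omega)
    have d₃ : thueMorse (2 * a + s + 3) ≠ thueMorse (2 * a + s + 4) := by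
      obtain rfl | hq4 : q = 3 ∨ 4 ≤ q := by omega
      · intro e
        exact d₀ (h₀.trans (e.trans h₁.symm))
      · exact alternating 3 (by omega)
    have e₁ := thueMorse_eq_iff_of_parity hs a (a + 1)
    have e₂ := thueMorse_eq_iff_of_parity hs (a + 1) (a + 2)
    rw [show 2 * (a + 1) + s = 2 * a + s + 2 by ring] at e₁ e₂
    rw [show 2 * (a + 2) + s = 2 * a + s + 4 by ring] at e₂
    refine thueMorse_not_three_equal a ⟨e₁.1 ?_, e₂.1 ?_⟩
    · exact Bool.eq_of_ne_of_ne d₀ d₁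
    · exact Bool.eq_of_ne_of_ne d₂ d₃

/-- The image of the Thue–Morse word under the morphism `0 ↦ 100`, `1 ↦ 010`. -/
def thueMorseImage (m : ℕ) : Bool :=
  if m % 3 = 0 then !thueMorse (m / 3) else if m % 3 = 1 then thueMorse (m / 3) else false

theorem thueMorseImage_three_mul (n : ℕ) : thueMorseImage (3 * n) = !thueMorse n := by
  simp [thueMorseImage]

theorem thueMorseImage_three_mul_add_one (n : ℕ) :
    thueMorseImage (3 * n + 1) = thueMorse n := by
  simp [thueMorseImage, show (3 * n + 1) % 3 = 1 by omega, show (3 * n + 1) / 3 = n by omega]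

theorem thueMorseImage_three_mul_add_two (n : ℕ) : thueMorseImage (3 * n + 2) = false := by
  simp [thueMorseImage]

/-- A block of length `3 * p + 1` in the image word does not have period `p`. -/
theorem thueMorseImage_not_periodic (p : ℕ) (hp : 1 ≤ p) (i : ℕ) :
    ¬∀ j ≤ 2 * p, thueMorseImage (i + j) = thueMorseImage (i + j + p) := by
  intro h
  have h' : ∀ m, i ≤ m → m ≤ i + 2 * p → thueMorseImage m = thueMorseImage (m + p) := by
    intro m h₁ h₂
    have := h (m - i) (by omega)
    rwa [show i + (m - i) = m by omega] at this
  obtain ⟨q, hq⟩ : ∃ q, p = 3 * q ∨ p = 3 * q + 1 ∨ p = 3 * q + 2 := ⟨p / 3, by omega⟩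
  -- the first multiple of three in the block
  obtain ⟨a, ha₁, ha₂⟩ : ∃ a, i ≤ 3 * a ∧ 3 * a ≤ i + 2 := ⟨(i + 2) / 3, by omega, by omega⟩
  rcases hq with rfl | rfl | rfl
  · refine thueMorse_overlap_free q (by omega) a fun j hj => ?_
    have := h' (3 * (a + j)) (by omega) (by omega)
    rw [show 3 * (a + j) + 3 * q = 3 * (a + j + q) by ring] at this
    simpa [thueMorseImage_three_mul] using this
  · have letter : ∀ n, i ≤ 3 * n + 1 → 3 * n + 1 ≤ i + 2 * (3 * q + 1) →
        thueMorse n = false := by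
      intro n h₁ h₂
      have := h' (3 * n + 1) h₁ h₂
      rwa [show 3 * n + 1 + (3 * q + 1) = 3 * (n + q) + 2 by ring,
        thueMorseImage_three_mul_add_one, thueMorseImage_three_mul_add_two] at this
    have letter' : ∀ n, i ≤ 3 * n + 2 → 3 * n + 2 ≤ i + 2 * (3 * q + 1) →
        thueMorse (n + q + 1) = true := by
      intro n h₁ h₂
      have := h' (3 * n + 2) h₁ h₂
      rw [show 3 * n + 2 + (3 * q + 1) = 3 * (n + q + 1) by ring,
        thueMorseImage_three_mul, thueMorseImage_three_mul_add_two] at this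
      simpa using this
    rcases Nat.eq_zero_or_pos q with rfl | hq
    · obtain h₀ | h₀ | h₀ : i = 3 * a ∨ i + 1 = 3 * a ∨ i + 2 = 3 * a := by omega
      · have e₁ := h' (3 * a) (by omega) (by omega)
        have e₂ := letter a (by omega) (by omega)
        simp [thueMorseImage_three_mul, thueMorseImage_three_mul_add_one, e₂] at e₁
      · obtain ⟨b, rfl⟩ : ∃ b, a = b + 1 := ⟨a - 1, by omega⟩
        have e₁ := letter' b (by omega) (by omega)
        have e₂ := letter (b + 1) (by omega) (by omega)
        simp [e₂] at e₁
      · obtain ⟨b, rfl⟩ : ∃ b, a = b + 1 := ⟨a - 1, by omega⟩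
        have e₁ := h' (3 * (b + 1)) (by omega) (by omega)
        have e₂ := letter' b (by omega) (by omega)
        simp only [add_zero] at e₂
        simp [thueMorseImage_three_mul, thueMorseImage_three_mul_add_one, e₂] at e₁
    · obtain ⟨b, hb₁, hb₂⟩ : ∃ b, i ≤ 3 * b + 1 ∧ 3 * b ≤ i + 1 :=
        ⟨(i + 1) / 3, by omega, by omega⟩
      have e₀ := letter b (by omega) (by omega)
      have e₁ := letter (b + 1) (by omega) (by omega)
      have e₂ := letter (b + 2) (by omega) (by omega)
      exact thueMorse_not_three_equal b ⟨e₀.trans e₁.symm, e₁.trans e₂.symm⟩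
  · have letter : ∀ n, i ≤ 3 * n → 3 * n ≤ i + 2 * (3 * q + 2) → thueMorse n = true := by
      intro n h₁ h₂
      have := h' (3 * n) h₁ h₂
      rw [show 3 * n + (3 * q + 2) = 3 * (n + q) + 2 by ring,
        thueMorseImage_three_mul, thueMorseImage_three_mul_add_two] at this
      simpa using this
    have letter' : ∀ n, i ≤ 3 * n + 2 → 3 * n + 2 ≤ i + 2 * (3 * q + 2) →
        thueMorse (n + q + 1) = false := by
      intro n h₁ h₂
      have := h' (3 * n + 2) h₁ h₂
      rw [show 3 * n + 2 + (3 * q + 2) = 3 * (n + q + 1) + 1 by ring,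
        thueMorseImage_three_mul_add_one, thueMorseImage_three_mul_add_two] at this
      exact this.symm
    rcases Nat.eq_zero_or_pos q with rfl | hq
    · obtain ⟨b, hb₁, hb₂⟩ : ∃ b, i ≤ 3 * b + 2 ∧ 3 * b ≤ i :=
        ⟨i / 3, by omega, by omega⟩
      have e₁ := letter' b (by omega) (by omega)
      have e₂ := letter (b + 1) (by omega) (by omega)
      simp [e₂] at e₁
    · have e₀ := letter a (by omega) (by omega)
      have e₁ := letter (a + 1) (by omega) (by omega)
      have e₂ := letter (a + 2) (by omega) (by omega)
      exact thueMorse_not_three_equal a ⟨e₀.trans e₁.symm, e₁.trans e₂.symm⟩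

theorem thueMorseImage_not_adjacent_ones (m : ℕ) :
    ¬(thueMorseImage m = true ∧ thueMorseImage (m + 1) = true) := by
  rintro ⟨h₁, h₂⟩
  obtain ⟨n, rfl | rfl | rfl⟩ : ∃ n, m = 3 * n ∨ m = 3 * n + 1 ∨ m = 3 * n + 2 :=
    ⟨m / 3, by omega⟩
  · simp [thueMorseImage_three_mul, thueMorseImage_three_mul_add_one] at h₁ h₂
    simp [h₁] at h₂
  · simp [thueMorseImage_three_mul_add_two] at h₂
  · simp [thueMorseImage_three_mul_add_two] at h₁

theorem thueMorseImage_not_alternating_ones (m : ℕ) :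
    ¬(thueMorseImage m = true ∧ thueMorseImage (m + 2) = true ∧
      thueMorseImage (m + 4) = true) := by
  rintro ⟨h₀, h₂, h₄⟩
  obtain ⟨n, rfl | rfl | rfl⟩ : ∃ n, m = 3 * n ∨ m = 3 * n + 1 ∨ m = 3 * n + 2 :=
    ⟨m / 3, by omega⟩
  · simp [thueMorseImage_three_mul_add_two] at h₂
  · rw [show 3 * n + 1 + 4 = 3 * (n + 1) + 2 by ring, thueMorseImage_three_mul_add_two] at h₄
    simp at h₄
  · simp [thueMorseImage_three_mul_add_two] at h₀

/-- No block of length five of the image word is the complement of another one. -/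
theorem thueMorseImage_not_complementary (i j : ℕ) :
    ¬∀ k < 5, thueMorseImage (j + k) = !thueMorseImage (i + k) := by
  intro h
  have alternating : ∀ k < 4, thueMorseImage (i + k + 1) = !thueMorseImage (i + k) := by
    intro k hk
    have e₁ := h k (by omega)
    have e₂ := h (k + 1) (by omega)
    have n₁ := thueMorseImage_not_adjacent_ones (i + k)
    have n₂ := thueMorseImage_not_adjacent_ones (j + k)
    rw [← add_assoc, ← add_assoc] at e₂
    rw [e₁, e₂] at n₂
    revert n₁ n₂
    cases thueMorseImage (i + k) <;> cases thueMorseImage (i + k + 1) <;> simp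
  have a₀ := alternating 0 (by omega)
  have a₁ := alternating 1 (by omega)
  have a₂ := alternating 2 (by omega)
  have a₃ := alternating 3 (by omega)
  simp only [add_zero, add_assoc, Nat.reduceAdd] at a₀ a₁ a₂ a₃
  cases hi : thueMorseImage i
  · apply thueMorseImage_not_alternating_ones j
    have h₀ := h 0 (by omega)
    rw [add_zero, add_zero] at h₀
    simp [h₀, h 2 (by omega), h 4 (by omega), a₃, a₂, a₁, a₀, hi]
  · apply thueMorseImage_not_alternating_ones i
    simp [a₃, a₂, a₁, a₀, hi]

theorem hasPeriod_minPeriod {α : Type*} {u : List α} (hu : u ≠ []) :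
    HasPeriod u (minPeriod u) :=
  Nat.sInf_mem (s := {p | HasPeriod u p})
    ⟨u.length, List.length_pos_iff.2 hu, fun i hi => by omega⟩

theorem FactorN.exists_getElem? {α : Type*} {w : ℕ → α} {x : List α} (h : FactorN w x) :
    ∃ i, ∀ k < x.length, x[k]? = some (w (i + k)) := by
  obtain ⟨i, hi⟩ := h
  refine ⟨i, fun k hk => ?_⟩
  rw [hi]
  simp [hk]

theorem stmt2 :
    ∃ w : ℕ → Bool,
      (∀ x : List Bool, FactorN w x → x ≠ [] → expo x ≤ (3 : ℝ)) ∧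
      (∀ x : List Bool, 5 ≤ x.length → ¬(FactorN w x ∧ FactorN w (comp x))) := by
  refine ⟨thueMorseImage, fun x hx hne => ?_, fun x hlen ⟨hx, hc⟩ => ?_⟩
  · obtain ⟨hp, hper⟩ := hasPeriod_minPeriod hne
    obtain ⟨i, hi⟩ := hx.exists_getElem?
    have hle : x.length ≤ 3 * minPeriod x := by
      by_contra hlt
      refine thueMorseImage_not_periodic _ hp i fun j hj => ?_
      have := hper j (by omega)
      rw [hi _ (by omega), hi _ (by omega), ← add_assoc] at this
      exact Option.some.inj this
    rw [expo, div_le_iff₀ (by exact_mod_cast hp)]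
    exact_mod_cast hle
  · obtain ⟨i, hi⟩ := hx.exists_getElem?
    obtain ⟨j, hj⟩ := hc.exists_getElem?
    refine thueMorseImage_not_complementary i j fun k hk => ?_
    have := hj k (by simp only [comp, List.length_map]; omega)
    rw [comp, List.getElem?_map, hi k (by omega)] at this
    exact (Option.some.inj this).symm
end

section
/- There exists an infinite binary word w that is (5/2)⁺-free such that the set of nonempty binary words x for which both x and its complement x̄ are factors of w has at most 36 elements. -/
/-- The block of length `n` of the infinite word `u` starting at position `i`. -/
def window {α : Type*} (u : ℕ → α) (i n : ℕ) : List α :=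
  (List.range n).map fun k => u (i + k)

/-- The total weight of the block of length `n` of `u` starting at position `i`. -/
def weight {α : Type*} (ω : α → ℕ) (u : ℕ → α) (i n : ℕ) : ℕ :=
  ((window u i n).map ω).sum

/-- The length of the image under `h` of the prefix of length `n` of `x`. -/
def blockStart {α β : Type*} (h : α → List β) (x : ℕ → α) (n : ℕ) : ℕ :=
  ((window x 0 n).flatMap h).length

/-- The infinite word `u` is the image of the infinite word `x` under the morphism `h`. -/
def IsImage {α β : Type*} (h : α → List β) (x : ℕ → α) (u : ℕ → β) : Prop :=
  ∀ n, (window x 0 n).flatMap h = window u 0 (blockStart h x n)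

/-- The blocks of length `m` of `u` at positions `i` and `i + q` agree. -/
def Repeats {α : Type*} (u : ℕ → α) (i q m : ℕ) : Prop :=
  ∀ k < m, u (i + k) = u (i + q + k)

section Windows

variable {α : Type*}

@[simp] theorem length_window (u : ℕ → α) (i n : ℕ) : (window u i n).length = n := by
  simp [window]

theorem window_add (u : ℕ → α) (i m n : ℕ) :
    window u i (m + n) = window u i m ++ window u (i + m) n := by
  simp [window, List.range_add, Function.comp_def, Nat.add_assoc]

theorem window_succ (u : ℕ → α) (i n : ℕ) :
    window u i (n + 1) = window u i n ++ [u (i + n)] := by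
  rw [window_add]; simp [window]

@[simp] theorem window_one (u : ℕ → α) (i : ℕ) : window u i 1 = [u i] := by
  simp [window]

theorem getElem?_window {u : ℕ → α} {i n k : ℕ} (hk : k < n) :
    (window u i n)[k]? = some (u (i + k)) := by
  simp [window, hk]

theorem take_window {u : ℕ → α} {i n k : ℕ} (hk : k ≤ n) :
    (window u i n).take k = window u i k := by
  obtain ⟨d, rfl⟩ := Nat.exists_eq_add_of_le hk
  rw [window_add, List.take_left' (length_window _ _ _)]

theorem drop_window (u : ℕ → α) (i n k : ℕ) :
    (window u i n).drop k = window u (i + k) (n - k) := by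
  rcases le_total k n with hk | hk
  · obtain ⟨d, rfl⟩ := Nat.exists_eq_add_of_le hk
    rw [window_add, List.drop_left' (length_window _ _ _), Nat.add_sub_cancel_left]
  · rw [List.drop_eq_nil_of_le (by simpa using hk), Nat.sub_eq_zero_of_le hk]
    simp [window]

theorem eq_window_of_prefix {l : List α} {u : ℕ → α} {i n : ℕ} (h : l <+: window u i n) :
    l = window u i l.length := by
  have hl : l.length ≤ n := by simpa using h.length_le
  rw [← take_window hl]
  exact List.prefix_iff_eq_take.mp h

theorem Repeats.window_eq {u : ℕ → α} {i q m : ℕ} (h : Repeats u i q m) {k n : ℕ}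
    (hk : k + n ≤ m) : window u (i + k) n = window u (i + k + q) n := by
  refine List.map_congr_left fun j hj => ?_
  have := h (k + j) (by have := List.mem_range.mp hj; omega)
  convert this using 2 <;> omega

theorem weight_add (ω : α → ℕ) (u : ℕ → α) (i m n : ℕ) :
    weight ω u i (m + n) = weight ω u i m + weight ω u (i + m) n := by
  simp [weight, window_add]

theorem weight_mono (ω : α → ℕ) (u : ℕ → α) (i : ℕ) {m n : ℕ} (h : m ≤ n) :
    weight ω u i m ≤ weight ω u i n := by
  obtain ⟨d, rfl⟩ := Nat.exists_eq_add_of_le h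
  rw [weight_add]; omega

theorem weight_one (u : ℕ → α) (i n : ℕ) : weight (fun _ => 1) u i n = n := by
  simp [weight]

/-- The prefixes of an infinite word can be prescribed along an increasing chain. -/
theorem exists_window_eq_of_prefix_chain [Inhabited α] (P : ℕ → List α)
    (hP : ∀ n, P n <+: P (n + 1)) (hlen : ∀ n, n ≤ (P n).length) :
    ∃ u : ℕ → α, ∀ n, P n = window u 0 (P n).length := by
  have hmono : ∀ m n, m ≤ n → P m <+: P n := by
    intro m n hmn
    induction n, hmn using Nat.le_induction with
    | base => exact List.prefix_rfl
    | succ n _ ih => exact ih.trans (hP n)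
  refine ⟨fun k => ((P (k + 1))[k]?).getD default, fun n => ?_⟩
  refine List.ext_getElem? fun k => ?_
  rcases lt_or_ge k (P n).length with hk | hk
  · rw [getElem?_window hk, Nat.zero_add]
    have hk' : k < (P (k + 1)).length := hlen (k + 1)
    have key : (P n)[k]? = (P (k + 1))[k]? := by
      rcases le_total n (k + 1) with hn | hn
      · obtain ⟨t, ht⟩ := hmono _ _ hn
        rw [← ht, List.getElem?_append_left hk]
      · obtain ⟨t, ht⟩ := hmono _ _ hn
        rw [← ht, List.getElem?_append_left hk']
    rw [key, List.getElem?_eq_getElem hk', Option.getD_some]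
  · rw [List.getElem?_eq_none hk, List.getElem?_eq_none (by simpa using hk)]

end Windows

section Images

variable {α β γ : Type*} {h : α → List β} {x : ℕ → α} {u : ℕ → β}

theorem blockStart_add (h : α → List β) (x : ℕ → α) (j r : ℕ) :
    blockStart h x (j + r) = blockStart h x j + ((window x j r).flatMap h).length := by
  simp [blockStart, window_add]

theorem blockStart_succ (h : α → List β) (x : ℕ → α) (j : ℕ) :
    blockStart h x (j + 1) = blockStart h x j + (h (x j)).length := by
  simp [blockStart_add]

theorem strictMono_blockStart (hne : ∀ a, h a ≠ []) (x : ℕ → α) :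
    StrictMono (blockStart h x) :=
  strictMono_nat_of_lt_succ fun n => by
    rw [blockStart_succ]
    have := List.length_pos_iff.mpr (hne (x n))
    omega

theorem exists_blockStart_add_eq (hne : ∀ a, h a ≠ []) (x : ℕ → α) (n : ℕ) :
    ∃ j t, n = blockStart h x j + t ∧ t < (h (x j)).length := by
  induction n with
  | zero => exact ⟨0, 0, by simp [blockStart, window], List.length_pos_iff.mpr (hne _)⟩
  | succ n ih =>
    obtain ⟨j, t, rfl, ht⟩ := ih
    rcases Nat.lt_or_ge (t + 1) (h (x j)).length with hlt | hge
    · exact ⟨j, t + 1, by omega, hlt⟩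
    · exact ⟨j + 1, 0, by rw [blockStart_succ]; omega, List.length_pos_iff.mpr (hne _)⟩

theorem IsImage.flatMap_window (H : IsImage h x u) (j r : ℕ) :
    (window x j r).flatMap h =
      window u (blockStart h x j) ((window x j r).flatMap h).length := by
  have := H (j + r)
  rw [blockStart_add, window_add, window_add, List.flatMap_append, H j, Nat.zero_add,
    Nat.zero_add] at this
  exact List.append_cancel_left this

theorem IsImage.comp {k : β → List γ} {v : ℕ → γ} (H : IsImage h x u) (H' : IsImage k u v) :
    IsImage (fun a => (h a).flatMap k) x v := by
  intro n
  have e : (window x 0 n).flatMap (fun a => (h a).flatMap k) =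
      ((window x 0 n).flatMap h).flatMap k := by simp [List.flatMap_assoc]
  rw [blockStart, e, H n, H' _]
  simp

theorem exists_isImage [Inhabited β] (hne : ∀ a, h a ≠ []) (x : ℕ → α) :
    ∃ u, IsImage h x u := by
  refine exists_window_eq_of_prefix_chain (fun n => (window x 0 n).flatMap h) (fun n => ?_)
    (fun n => (strictMono_blockStart hne x).le_apply)
  rw [window_succ, List.flatMap_append]
  exact List.prefix_append _ _

/-- A morphism that maps a letter `a` to a word with first letter `a` has a fixed point. -/
theorem exists_isImage_self {f : α → List α} (hf : ∀ a, 2 ≤ (f a).length) (a : α)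
    (ha : [a] <+: f a) : ∃ p, p 0 = a ∧ IsImage f p p := by
  have : Inhabited α := ⟨a⟩
  let P : ℕ → List α := fun n => (fun l => l.flatMap f)^[n] [a]
  have hs : ∀ n, P (n + 1) = (P n).flatMap f := fun n => Function.iterate_succ_apply' _ _ _
  have hpre : ∀ n, P n <+: P (n + 1) := by
    intro n
    induction n with
    | zero => simpa [P] using ha
    | succ n ih =>
      rw [hs, hs (n + 1)]
      obtain ⟨t, ht⟩ := ih
      exact ⟨t.flatMap f, by rw [← List.flatMap_append, ht]⟩
  have hgrow : ∀ l : List α, 2 * l.length ≤ (l.flatMap f).length := by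
    intro l
    induction l with
    | nil => simp
    | cons b l ih => have := hf b; simp only [List.flatMap_cons, List.length_append,
        List.length_cons]; omega
  have hlen : ∀ n, n + 1 ≤ (P n).length := by
    intro n
    induction n with
    | zero => simp [P]
    | succ n ih => have := hgrow (P n); rw [hs]; omega
  obtain ⟨p, hp⟩ := exists_window_eq_of_prefix_chain P hpre fun n => by have := hlen n; omega
  refine ⟨p, ?_, fun n => ?_⟩
  · have := hp 0
    simpa [P, eq_comm] using this
  · refine eq_window_of_prefix (n := (P (n + 1)).length) ?_
    rw [← hp, hs, hp n]
    have h1 : (P n).length = n + ((P n).length - n) := by have := hlen n; omega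
    rw [h1, window_add, List.flatMap_append]
    exact List.prefix_append _ _

end Images

section Desubstitution

variable {α β : Type*}

/-- Conditions under which repetitions in an image under `h` come from repetitions in the preimage.
Every image begins with the marker `s`, which occurs in images of words only at the beginning of
a block. Images of distinct letters share at most the prefix `R` and the suffix `L`. -/
structure IsCoding (h : α → List β) (s L R : List β) : Prop where
  ne_nil : ∀ a, h a ≠ []
  marker_prefix : ∀ a, s <+: h a
  marker_sync : ∀ a, ∀ t < (h a).length, 0 < t → ((h a ++ s).drop t).take s.length ≠ s
  right_mismatch : ∀ a b, a ≠ b → ∃ t, t < (h a ++ s).length ∧ t < (h b ++ s).length ∧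
    (h a ++ s)[t]? ≠ (h b ++ s)[t]? ∧ (h a ++ s).take t <+: R
  left_mismatch : ∀ a b, a ≠ b → ∃ t, t < (h a).length ∧ t < (h b).length ∧
    (h a)[(h a).length - 1 - t]? ≠ (h b)[(h b).length - 1 - t]? ∧
    (h a).drop ((h a).length - t) <:+ L

variable {h : α → List β} {s L R : List β} {x : ℕ → α} {u : ℕ → β}

theorem IsImage.eq_window (H : IsImage h x u) (j : ℕ) :
    h (x j) = window u (blockStart h x j) (h (x j)).length := by
  simpa using H.flatMap_window j 1

theorem IsImage.append_eq_window (H : IsImage h x u) (hs : ∀ a, s <+: h a) (j : ℕ) :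
    h (x j) ++ s = window u (blockStart h x j) (h (x j) ++ s).length := by
  have e := H.flatMap_window j 2
  refine eq_window_of_prefix (n := ((window x j 2).flatMap h).length) ?_
  rw [← e, window_add x j 1 1]
  obtain ⟨t, ht⟩ := hs (x (j + 1))
  exact ⟨t, by simp [← ht]⟩

theorem IsImage.weight_blockStart (H : IsImage h x u) (ω : β → ℕ) (j r : ℕ) :
    weight ω u (blockStart h x j) (blockStart h x (j + r) - blockStart h x j) =
      weight (fun a => ((h a).map ω).sum) x j r := by
  rw [blockStart_add, Nat.add_sub_cancel_left, weight, ← H.flatMap_window, weight]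
  induction window x j r with
  | nil => rfl
  | cons a l ih => simp [ih]

theorem IsCoding.marker_iff (C : IsCoding h s L R) (H : IsImage h x u) (n : ℕ) :
    window u n s.length = s ↔ ∃ j, blockStart h x j = n := by
  constructor
  · intro hn
    obtain ⟨j, t, rfl, ht⟩ := exists_blockStart_add_eq C.ne_nil x n
    rcases Nat.eq_zero_or_pos t with rfl | h0
    · exact ⟨j, rfl⟩
    · refine absurd ?_ (C.marker_sync (x j) t ht h0)
      rw [H.append_eq_window C.marker_prefix j, drop_window, take_window, hn]
      simp only [List.length_append]
      omega
  · rintro ⟨j, rfl⟩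
    have h1 := (C.marker_prefix (x j))
    rw [H.eq_window j] at h1
    exact (eq_window_of_prefix h1).symm

theorem Repeats.blockStart_add {j₁ q m : ℕ} (hx : Repeats x j₁ q m) :
    blockStart h x (j₁ + q + m) =
      blockStart h x (j₁ + q) + (blockStart h x (j₁ + m) - blockStart h x j₁) := by
  have := hx.window_eq (k := 0) (n := m) (by omega)
  simp only [Nat.add_zero] at this
  rw [_root_.blockStart_add, _root_.blockStart_add h x j₁ m, ← this]
  omega

/-- The part of a repetition that begins at a block boundary. -/
theorem IsCoding.exists_repeats_right (C : IsCoding h s L R) (H : IsImage h x u)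
    {j q q' m : ℕ} (hq : blockStart h x (j + q') = blockStart h x j + q)
    (hu : Repeats u (blockStart h x j) q m) :
    ∃ m', Repeats x j q' m' ∧ ∀ ω : β → ℕ, weight ω u (blockStart h x j) m ≤
      weight (fun a => ((h a).map ω).sum) x j m' + (R.map ω).sum := by
  classical
  have hmono := strictMono_blockStart C.ne_nil x
  have hex : ∃ k, x (j + k) ≠ x (j + q' + k) ∨ blockStart h x j + m ≤ blockStart h x (j + k) :=
    ⟨m, Or.inr (by
      clear hu hq
      induction m with
      | zero => simp
      | succ m ih => have := hmono (show j + m < j + (m + 1) by omega); omega)⟩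
  have hlt : ∀ k < Nat.find hex, x (j + k) = x (j + q' + k) := fun k hk => by
    have := Nat.find_min hex hk
    push Not at this
    exact this.1
  refine ⟨Nat.find hex, hlt, fun ω => ?_⟩
  have hspec := Nat.find_spec hex
  generalize Nat.find hex = m' at hlt hspec ⊢
  have hle : blockStart h x j ≤ blockStart h x (j + m') := hmono.monotone (by omega)
  rw [← H.weight_blockStart]
  by_cases hend : blockStart h x j + m ≤ blockStart h x (j + m')
  · have := weight_mono ω u (blockStart h x j)
      (show m ≤ blockStart h x (j + m') - blockStart h x j by omega)
    omega
  · obtain ⟨t, hta, htb, hne, hpre⟩ :=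
      C.right_mismatch _ _ (hspec.resolve_right hend)
    have hj := Repeats.blockStart_add (h := h) (q := q') (show Repeats x j q' m' from hlt)
    have ha := H.append_eq_window C.marker_prefix (j + m')
    have hb := H.append_eq_window C.marker_prefix (j + q' + m')
    rw [ha, hb, getElem?_window hta, getElem?_window htb, hj, hq] at hne
    have hmt : m ≤ blockStart h x (j + m') - blockStart h x j + t := by
      by_contra! hlt'
      refine hne (congrArg some ?_)
      have := hu _ hlt'
      convert this using 2 <;> omega
    have hR : weight ω u (blockStart h x (j + m')) t ≤ (R.map ω).sum := by
      rw [weight, ← take_window hta.le, ← ha]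
      exact (hpre.sublist.map ω).sum_le_sum (by simp)
    have h1 := weight_mono ω u (blockStart h x j) hmt
    rw [weight_add, Nat.add_sub_cancel' hle] at h1
    omega

/-- A long repetition in the image comes from a repetition in the preimage. -/
theorem IsCoding.exists_repeats (C : IsCoding h s L R) (H : IsImage h x u) {i q m : ℕ}
    (hq : 0 < q) (hm : ∀ a, (h a).length + s.length ≤ m + 1) (hu : Repeats u i q m) :
    ∃ i' q' m', 0 < q' ∧ Repeats x i' q' m' ∧
      (∀ ω : β → ℕ, weight ω u i q = weight (fun a => ((h a).map ω).sum) x i' q') ∧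
      ∀ ω : β → ℕ, weight ω u i m ≤ weight (fun a => ((h a).map ω).sum) x i' m' +
        (L.map ω).sum + (R.map ω).sum := by
  have hmono := strictMono_blockStart C.ne_nil x
  -- a block boundary `i + d` inside the repetition gives a boundary `i + d + q`
  have aligned : ∀ j d, blockStart h x j = i + d → d + s.length ≤ m →
      ∃ q' m', 0 < q' ∧ blockStart h x (j + q') = i + d + q ∧ Repeats x j q' m' ∧
        (∀ ω : β → ℕ, weight ω u i q = weight (fun a => ((h a).map ω).sum) x j q') ∧
        ∀ ω : β → ℕ, weight ω u i m ≤ weight ω u i d +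
          weight (fun a => ((h a).map ω).sum) x j m' + (R.map ω).sum := by
    intro j d hj hd
    have h1 := (C.marker_iff H (i + d)).mpr ⟨j, hj⟩
    rw [hu.window_eq hd] at h1
    obtain ⟨j₂, hj₂⟩ := (C.marker_iff H _).mp h1
    have hlt : j < j₂ := hmono.lt_iff_lt.mp (by omega)
    obtain ⟨q', rfl⟩ := Nat.exists_eq_add_of_lt hlt
    have hu' : Repeats u (blockStart h x j) q (m - d) := fun k hk => by
      have := hu (d + k) (by omega)
      rw [hj]
      convert this using 2 <;> omega
    obtain ⟨m', hm', hw⟩ := C.exists_repeats_right H (j := j) (q' := q' + 1)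
      (by rw [← Nat.add_assoc, hj₂, hj]) hu'
    refine ⟨q' + 1, m', by omega, by rw [← Nat.add_assoc, hj₂], hm', fun ω => ?_, fun ω => ?_⟩
    · rw [← H.weight_blockStart, ← Nat.add_assoc, hj₂, hj, Nat.add_sub_cancel_left]
      have e1 := weight_add ω u i d q
      have e2 := weight_add ω u i q d
      have e3 : weight ω u i d = weight ω u (i + q) d := by
        have := hu.window_eq (k := 0) (n := d) (by omega)
        rw [weight, weight]
        simpa using congrArg (fun l => (l.map ω).sum) this
      rw [Nat.add_comm d q] at e1
      omega
    · have := hw ω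
      have e := weight_add ω u i d (m - d)
      rw [Nat.add_sub_cancel' (by omega)] at e
      rw [hj] at this
      omega
  obtain ⟨j, t, rfl, ht⟩ := exists_blockStart_add_eq C.ne_nil x i
  have hlen := hm (x j)
  rcases Nat.eq_zero_or_pos t with rfl | h0
  · obtain ⟨q', m', hq', -, hr, hV, hW⟩ := aligned j 0 (by omega) (by omega)
    refine ⟨j, q', m', hq', hr, hV, fun ω => ?_⟩
    have := hW ω
    have e : weight ω u (blockStart h x j + 0) 0 = 0 := by simp [weight, window]
    omega
  · have hs := blockStart_succ h x j
    obtain ⟨q', m', hq', hend, hr, hV, hW⟩ :=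
      aligned (j + 1) ((h (x j)).length - t) (by omega) (by omega)
    by_cases hx : x j = x (j + q')
    · have hr' : Repeats x j q' (m' + 1) := by
        rintro (_ | k) hk
        · exact hx
        · have := hr k (by omega)
          convert this using 2 <;> omega
      refine ⟨j, q', m' + 1, hq', hr', fun ω => ?_, fun ω => ?_⟩
      · have e1 := weight_add (fun a => ((h a).map ω).sum) x j 1 q'
        have e2 := weight_add (fun a => ((h a).map ω).sum) x j q' 1
        have e3 : weight (fun a => ((h a).map ω).sum) x j 1 =
            weight (fun a => ((h a).map ω).sum) x (j + q') 1 := by simp [weight, hx]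
        rw [hV ω]
        rw [Nat.add_comm 1 q'] at e1
        omega
      · have h1 := hW ω
        have h2 := weight_add (fun a => ((h a).map ω).sum) x j 1 m'
        have h3 := H.weight_blockStart ω j 1
        have h4 := weight_add ω u (blockStart h x j) t ((h (x j)).length - t)
        rw [hs, Nat.add_sub_cancel_left] at h3
        rw [Nat.add_sub_cancel' ht.le] at h4
        rw [Nat.add_comm m' 1]
        omega
    · refine ⟨j + 1, q', m', hq', hr, hV, fun ω => ?_⟩
      obtain ⟨t', hta, htb, hne, hsuf⟩ := C.left_mismatch _ _ hx
      have ha := H.eq_window j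
      have hb := H.eq_window (j + q')
      have hs' := blockStart_succ h x (j + q')
      rw [show j + q' + 1 = j + 1 + q' by omega] at hs'
      have h1 : (h (x j)).length - t ≤ t' := by
        by_contra! hlt
        refine hne ?_
        have ea : (h (x j))[(h (x j)).length - 1 - t']? =
            some (u (blockStart h x j + ((h (x j)).length - 1 - t'))) := by
          conv_lhs => rw [ha]
          simp only [length_window]
          exact getElem?_window (by omega)
        have eb : (h (x (j + q')))[(h (x (j + q'))).length - 1 - t']? =
            some (u (blockStart h x (j + q') + ((h (x (j + q'))).length - 1 - t'))) := by
          conv_lhs => rw [hb]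
          simp only [length_window]
          exact getElem?_window (by omega)
        rw [ea, eb]
        have := hu ((h (x j)).length - 1 - t' - t) (by omega)
        refine congrArg some ?_
        convert this using 2 <;> omega
      have h2 : weight ω u (blockStart h x j + ((h (x j)).length - t')) t' ≤ (L.map ω).sum := by
        have e := drop_window u (blockStart h x j) (h (x j)).length ((h (x j)).length - t')
        rw [← ha, Nat.sub_sub_self hta.le] at e
        rw [weight, ← e]
        exact (hsuf.sublist.map ω).sum_le_sum (by simp)
      have h3 := weight_add ω u (blockStart h x j + ((h (x j)).length - t'))
        (t' - ((h (x j)).length - t)) ((h (x j)).length - t)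
      rw [Nat.sub_add_cancel h1, show blockStart h x j + ((h (x j)).length - t') +
        (t' - ((h (x j)).length - t)) = blockStart h x j + t by omega] at h3
      have := hW ω
      omega

end Desubstitution

section FiniteCheck

variable {α β : Type*}

/-- Every repetition of period `q` at position `i` satisfies `2 * |μ| + K ≤ 3 * |ρ|`, where `|μ|`
and `|ρ|` are the weights of the repeated part and of the period. -/
def RepetitionBound (ω : α → ℕ) (K : ℕ) (u : ℕ → α) (i q : ℕ) : Prop :=
  ∀ m, Repeats u i q m → 2 * weight ω u i m + K ≤ 3 * weight ω u i q

/-- Compares two words letter by letter, lowering the budget `T` by twice the weight of each common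
letter; succeeds if a mismatch is found before the budget drops below `K`. It is defined by
recursors to be evaluated efficiently by the kernel. -/
noncomputable def mismatchWithin [DecidableEq α] (ω : α → ℕ) (K : ℕ) (l : List α) :
    List α → ℕ → Bool :=
  List.rec (fun _ _ => false) (fun a _ ih l' T => List.rec false (fun b l'' _ =>
    Decidable.rec (motive := fun _ => Bool) (fun _ => Nat.ble K T)
      (fun _ => Bool.rec false (ih l'' (Nat.sub T (Nat.mul 2 (ω a))))
        (Nat.ble (Nat.add (Nat.mul 2 (ω a)) K) T))
      (inferInstance : Decidable (a = b))) l') l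

/-- The weight of the prefix of length `q` of a word. It is defined by recursors to be
evaluated efficiently by the kernel. -/
noncomputable def takeWeight (ω : α → ℕ) (q : ℕ) : List α → ℕ :=
  Nat.rec (fun _ => 0) (fun _ ih l => List.rec 0 (fun a l' _ => Nat.add (ω a) (ih l')) l) q

/-- Checks the repetitions of period `q` at the beginning of `l`. -/
noncomputable def checkPeriod [DecidableEq α] (ω : α → ℕ) (K q : ℕ) (l : List α) : Bool :=
  Nat.ble q l.length && mismatchWithin ω K l (l.drop q) (Nat.mul 3 (takeWeight ω q l))

theorem mismatchWithin_cons_cons [DecidableEq α] (ω : α → ℕ) (K : ℕ) (a b : α) (l l' : List α)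
    (T : ℕ) : mismatchWithin ω K (a :: l) (b :: l') T =
      if a = b then Nat.ble (2 * ω a + K) T && mismatchWithin ω K l l' (T - 2 * ω a)
      else Nat.ble K T := by
  have e : mismatchWithin ω K (a :: l) (b :: l') T =
      Decidable.rec (motive := fun _ => Bool) (fun _ => Nat.ble K T)
        (fun _ => Bool.rec false (mismatchWithin ω K l l' (T - 2 * ω a))
          (Nat.ble (2 * ω a + K) T)) (inferInstance : Decidable (a = b)) := rfl
  rw [e]
  rcases (inferInstance : Decidable (a = b)) with hab | hab
  · simp [hab]
  · simp only [hab, if_true]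
    cases Nat.ble (2 * ω b + K) T <;> rfl

theorem takeWeight_eq (ω : α → ℕ) (q : ℕ) (l : List α) :
    takeWeight ω q l = ((l.take q).map ω).sum := by
  induction q generalizing l with
  | zero => simp [takeWeight]
  | succ q ih =>
    cases l with
    | nil => simp [takeWeight]
    | cons a l =>
      have e : takeWeight ω (q + 1) (a :: l) = ω a + takeWeight ω q l := rfl
      rw [e, ih]
      simp

theorem takeWeight_window (ω : α → ℕ) (u : ℕ → α) (i : ℕ) {q n : ℕ} (h : q ≤ n) :
    takeWeight ω q (window u i n) = weight ω u i q := by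
  rw [takeWeight_eq, take_window h, weight]

theorem window_cons (u : ℕ → α) (i n : ℕ) :
    window u i (n + 1) = u i :: window u (i + 1) n := by
  rw [Nat.add_comm, window_add]; simp

theorem weight_succ (ω : α → ℕ) (u : ℕ → α) (i n : ℕ) :
    weight ω u i (n + 1) = ω (u i) + weight ω u (i + 1) n := by
  simp [weight, window_cons]

theorem mismatchWithin_sound [DecidableEq α] {ω : α → ℕ} {K : ℕ} {u : ℕ → α} {q : ℕ} (n n' : ℕ) :
    ∀ {i T : ℕ}, mismatchWithin ω K (window u i n) (window u (i + q) n') T = true →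
      ∀ m, Repeats u i q m → 2 * weight ω u i m + K ≤ T := by
  induction n generalizing n' with
  | zero => intro i T hc; simp [window, mismatchWithin] at hc
  | succ n ih =>
    intro i T hc m hm
    cases n' with
    | zero =>
      rw [window_cons] at hc
      exact absurd hc Bool.false_ne_true
    | succ n' =>
      rw [window_cons, window_cons, mismatchWithin_cons_cons] at hc
      split_ifs at hc with he
      · rw [Bool.and_eq_true] at hc
        have hT := Nat.le_of_ble_eq_true hc.1
        cases m with
        | zero => simp [weight, window]; omega
        | succ m =>
          rw [show i + q + 1 = i + 1 + q by omega] at hc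
          have := ih n' hc.2 m fun k hk => by
            have := hm (k + 1) (by omega)
            convert this using 2 <;> omega
          rw [weight_succ]
          omega
      · have hT := Nat.le_of_ble_eq_true hc
        cases m with
        | zero => simpa [weight, window] using hT
        | succ m => exact absurd (hm 0 (by omega)) he

theorem checkPeriod_sound [DecidableEq α] {ω : α → ℕ} {K q N : ℕ} {u : ℕ → α} {i : ℕ}
    (hc : checkPeriod ω K q (window u i N) = true) : RepetitionBound ω K u i q := by
  rw [checkPeriod, Bool.and_eq_true] at hc
  have hq := Nat.le_of_ble_eq_true hc.1
  rw [length_window] at hq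
  rw [drop_window, takeWeight_window _ _ _ hq] at hc
  exact mismatchWithin_sound N _ hc.2

/-- Tests a property of words on all suffixes of `l` that begin at one of the first `n`
positions. -/
def allSuffixes (P : List β → Bool) : ℕ → List β → Bool
  | 0, _ => true
  | n + 1, l => P l && allSuffixes P n l.tail

theorem allSuffixes_drop {P : List β → Bool} {n : ℕ} {l : List β}
    (hP : allSuffixes P n l = true) {t : ℕ} (ht : t < n) : P (l.drop t) = true := by
  induction n generalizing l t with
  | zero => omega
  | succ n ih =>
    rw [allSuffixes, Bool.and_eq_true] at hP
    cases t with
    | zero => exact hP.1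
    | succ t => simpa using ih hP.2 (t := t) (by omega)

/-- Tests a property on the suffixes of `h (X)`, for `X` in `F`, that begin in the image of the
first letter of `X`. -/
def allImageSuffixes (h : α → List β) (P : List β → Bool) (F : List (List α)) : Bool :=
  F.all fun X => allSuffixes P ((X.head?.map fun a => (h a).length).getD 0) (X.flatMap h)

theorem IsImage.exists_window_of_allImageSuffixes {h : α → List β} {x : ℕ → α} {u : ℕ → β}
    (H : IsImage h x u) (hne : ∀ a, h a ≠ []) {r : ℕ} (hr : 0 < r) {F : List (List α)}
    (hF : ∀ j, window x j r ∈ F) {P : List β → Bool} (hP : allImageSuffixes h P F = true)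
    (i : ℕ) : ∃ N, P (window u i N) = true := by
  obtain ⟨j, t, rfl, ht⟩ := exists_blockStart_add_eq hne x i
  have h1 := List.all_eq_true.mp hP _ (hF j)
  have hhead : (window x j r).head? = some (x j) := by
    obtain ⟨r, rfl⟩ := Nat.exists_eq_add_of_lt hr
    simp [window_cons]
  rw [hhead, H.flatMap_window j r] at h1
  exact ⟨_, by simpa only [drop_window] using allSuffixes_drop h1 ht⟩

end FiniteCheck

section TheWord

/-- The square of the morphism `0 ↦ 01`, `1 ↦ 21`, `2 ↦ 0`. -/
def innerMorphism : Fin 3 → List (Fin 3)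
  | 0 => [0, 1, 2, 1]
  | 1 => [0, 2, 1]
  | 2 => [0, 1]

/-- The morphism coding the ternary fixed point as a binary word. -/
def outerMorphism : Fin 3 → List Bool
  | 0 => [false, false, true, false, true, true, false, true, false, true, true]
  | 1 => [false, false, true, true, false, true, true]
  | 2 => [false, false, true, false, true, true]

/-- The factors of length four of the fixed point of `innerMorphism`. -/
def innerFactors : List (List (Fin 3)) :=
  [[0, 1, 0, 2], [0, 1, 2, 1], [0, 2, 1, 0], [1, 0, 1, 0], [1, 0, 1, 2], [1, 0, 2, 1],
    [1, 2, 1, 0], [2, 1, 0, 1], [2, 1, 0, 2]]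

theorem isCoding_innerMorphism : IsCoding innerMorphism [0] [2, 1] [0, 1] where
  ne_nil := by decide
  marker_prefix := by decide
  marker_sync := by decide
  right_mismatch := by
    have : ∀ a b : Fin 3, a ≠ b → ∃ t < 6, t < (innerMorphism a ++ [0]).length ∧
      t < (innerMorphism b ++ [0]).length ∧
      (innerMorphism a ++ [0])[t]? ≠ (innerMorphism b ++ [0])[t]? ∧
      (innerMorphism a ++ [0]).take t <+: [0, 1] := by decide
    intro a b hab
    obtain ⟨t, -, ht⟩ := this a b hab
    exact ⟨t, ht⟩
  left_mismatch := by
    have : ∀ a b : Fin 3, a ≠ b → ∃ t < 6, t < (innerMorphism a).length ∧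
      t < (innerMorphism b).length ∧
      (innerMorphism a)[(innerMorphism a).length - 1 - t]? ≠
        (innerMorphism b)[(innerMorphism b).length - 1 - t]? ∧
      (innerMorphism a).drop ((innerMorphism a).length - t) <:+ [2, 1] := by decide
    intro a b hab
    obtain ⟨t, -, ht⟩ := this a b hab
    exact ⟨t, ht⟩

theorem isCoding_outerMorphism : IsCoding outerMorphism [false, false]
    [false, true, false, true, true] [false, false, true, false, true, true, false] where
  ne_nil := by decide
  marker_prefix := by decide
  marker_sync := by decide
  right_mismatch := by
    have : ∀ a b : Fin 3, a ≠ b → ∃ t < 8, t < (outerMorphism a ++ [false, false]).length ∧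
      t < (outerMorphism b ++ [false, false]).length ∧
      (outerMorphism a ++ [false, false])[t]? ≠ (outerMorphism b ++ [false, false])[t]? ∧
      (outerMorphism a ++ [false, false]).take t <+:
        [false, false, true, false, true, true, false] := by decide
    intro a b hab
    obtain ⟨t, -, ht⟩ := this a b hab
    exact ⟨t, ht⟩
  left_mismatch := by
    have : ∀ a b : Fin 3, a ≠ b → ∃ t < 8, t < (outerMorphism a).length ∧
      t < (outerMorphism b).length ∧
      (outerMorphism a)[(outerMorphism a).length - 1 - t]? ≠
        (outerMorphism b)[(outerMorphism b).length - 1 - t]? ∧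
      (outerMorphism a).drop ((outerMorphism a).length - t) <:+
        [false, true, false, true, true] := by decide
    intro a b hab
    obtain ⟨t, -, ht⟩ := this a b hab
    exact ⟨t, ht⟩

variable {p : ℕ → Fin 3} {w : ℕ → Bool}

theorem window_four_mem_innerFactors (hp : IsImage innerMorphism p p) (h0 : p 0 = 0) (i : ℕ) :
    window p i 4 ∈ innerFactors := by
  have step : ∀ X ∈ innerFactors, ∀ t < ((X.head?.map fun a => (innerMorphism a).length).getD 0),
      t + 4 ≤ (X.flatMap innerMorphism).length ∧
      ((X.flatMap innerMorphism).drop t).take 4 ∈ innerFactors := by decide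
  induction i using Nat.strong_induction_on with
  | _ i ih =>
    obtain ⟨j, t, rfl, ht⟩ := exists_blockStart_add_eq isCoding_innerMorphism.ne_nil p i
    rcases Nat.eq_zero_or_pos j with rfl | hj
    · have e := hp.eq_window 0
      have e0 : blockStart innerMorphism p 0 = 0 := rfl
      have e4 : window p 0 4 = [0, 1, 2, 1] := by simpa [h0, innerMorphism, e0, eq_comm] using e
      have hs := step [0, 1, 2, 1] (by decide) t (by simpa [h0] using ht)
      have e' := hp.flatMap_window 0 4
      rw [e4, e0] at e'
      rw [e', length_window, drop_window, take_window (by omega)] at hs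
      rw [e0]
      exact hs.2
    · have hlt : j < blockStart innerMorphism p j := by
        have h2 : ∀ n, 2 * n ≤ blockStart innerMorphism p n := by
          intro n
          induction n with
          | zero => simp
          | succ n ihn =>
            have : ∀ a, 2 ≤ (innerMorphism a).length := by decide
            have := this (p n)
            rw [blockStart_succ]
            omega
        have := h2 j
        omega
      have hs := step _ (ih j (by omega)) t (by simpa [window_cons] using ht)
      rw [hp.flatMap_window j 4, length_window, drop_window, take_window (by omega)] at hs
      exact hs.2

/-- The weight function on ternary letters with the given values. -/
def letterWeight (a b c : ℕ) : Fin 3 → ℕ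
  | 0 => a
  | 1 => b
  | 2 => c

theorem weight_letterWeight (a b c i n : ℕ) : weight (letterWeight a b c) p i n =
    a * weight (letterWeight 1 0 0) p i n + b * weight (letterWeight 0 1 0) p i n +
      c * weight (letterWeight 0 0 1) p i n := by
  induction n with
  | zero => rfl
  | succ n ih =>
    simp only [weight_add _ p i n 1, ih]
    have : ∀ d : Fin 3, letterWeight a b c d = a * letterWeight 1 0 0 d +
        b * letterWeight 0 1 0 d + c * letterWeight 0 0 1 d := by
      intro d; fin_cases d <;> simp [letterWeight]
    simp only [weight, window_one, List.map_cons, List.map_nil, List.sum_singleton,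
      this (p (i + n))]
    ring

theorem weight_letterWeight_one (i n : ℕ) : weight (letterWeight 1 1 1) p i n = n := by
  have : letterWeight 1 1 1 = fun _ => 1 := by decide
  rw [this, weight_one]

theorem sum_map_innerMorphism (a b c : ℕ) :
    (fun d => ((innerMorphism d).map (letterWeight a b c)).sum) =
      letterWeight (a + 2 * b + c) (a + b + c) (a + b) := by
  funext d
  fin_cases d <;> simp [innerMorphism, letterWeight] <;> ring

theorem sum_map_one_innerMorphism :
    (fun d => ((innerMorphism d).map fun _ => 1).sum) = letterWeight 4 3 2 := by decide

theorem sum_map_one_outerMorphism :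
    (fun d => ((outerMorphism d).map fun _ => 1).sum) = letterWeight 11 7 6 := by decide

/-- The square of `innerMorphism`. -/
def innerMorphismSq (a : Fin 3) : List (Fin 3) := (innerMorphism a).flatMap innerMorphism

/-- The third power of `innerMorphism`. -/
def innerMorphismCube (a : Fin 3) : List (Fin 3) := (innerMorphismSq a).flatMap innerMorphism

/-- The fourth power of `innerMorphism`. -/
def innerMorphismPowFour (a : Fin 3) : List (Fin 3) := (innerMorphismSq a).flatMap innerMorphismSq

theorem isImage_innerMorphismSq (hp : IsImage innerMorphism p p) : IsImage innerMorphismSq p p :=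
  hp.comp hp

/-- The conditions on a repetition, as pairs of a weight function and a constant for
`RepetitionBound`, that are propagated from preimages to images under `innerMorphism`. -/
def stableBounds : List ((Fin 3 → ℕ) × ℕ) :=
  [(letterWeight 1 0 0, 1), (letterWeight 0 1 0, 1), (letterWeight 0 0 1, 1),
    (letterWeight 1 1 0, 3), (letterWeight 1 1 1, 4)]

/-- Conditions on a repetition that imply `stableBounds` for its image under `innerMorphism`. -/
def preimageBounds : List ((Fin 3 → ℕ) × ℕ) :=
  [(letterWeight 1 1 1, 3), (letterWeight 2 1 1, 5), (letterWeight 1 1 0, 3),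
    (letterWeight 3 2 2, 9), (letterWeight 4 3 2, 12)]

/-- The periods for which repetitions in the fixed point are examined directly. -/
def innerExceptions : List ℕ := [28, 49, 65]

/-- The periods for which repetitions in the binary word are examined directly. -/
def outerExceptions : List ℕ := [1, 2, 3, 4, 5, 6, 7, 18, 55]

/-- The finite check on repetitions of the fixed point with period less than `22`. -/
noncomputable def checkShortPeriods (l : List (Fin 3)) : Bool :=
  Nat.ble 22 l.length && (List.range 22).all fun q =>
    (q == 0 || Nat.ble (takeWeight (letterWeight 4 3 2) q l) 21 ||
      innerExceptions.contains (takeWeight (letterWeight 4 3 2) q l) ||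
      preimageBounds.all fun B => checkPeriod B.1 B.2 q l) &&
    (q == 0 || outerExceptions.contains (takeWeight (letterWeight 11 7 6) q l) ||
      checkPeriod (letterWeight 11 7 6) 24 q l)

/-- Checks that each letter occurs at least three times among the first `22` letters of `l`. -/
noncomputable def checkCounts (l : List (Fin 3)) : Bool :=
  Nat.ble 22 l.length && [letterWeight 1 0 0, letterWeight 0 1 0, letterWeight 0 0 1].all fun ω =>
    Nat.ble 3 (takeWeight ω 22 l)

/-- The finite check on repetitions of the fixed point whose period is in `innerExceptions`. It only
concerns repetitions that contain a square. -/
noncomputable def checkInnerExceptions (l : List (Fin 3)) : Bool :=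
  innerExceptions.all fun q => Nat.ble q l.length &&
    (mismatchWithin (fun _ => 1) 2 l (l.drop q) (2 * q) ||
      stableBounds.all fun B => checkPeriod B.1 B.2 q l)

theorem allImageSuffixes_checkShortPeriods :
    allImageSuffixes innerMorphismCube checkShortPeriods innerFactors = true := by
  decide +kernel

theorem allImageSuffixes_checkCounts :
    allImageSuffixes innerMorphismSq checkCounts innerFactors = true := by
  decide +kernel

theorem allImageSuffixes_checkInnerExceptions :
    allImageSuffixes innerMorphismPowFour checkInnerExceptions innerFactors = true := by
  decide +kernel

theorem allImageSuffixes_checkOuterExceptions :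
    allImageSuffixes (fun a => (innerMorphismSq a).flatMap outerMorphism)
      (fun l => outerExceptions.all fun q => checkPeriod (fun _ => 1) 0 q l) innerFactors =
      true := by
  decide +kernel

theorem repetitionBound_of_repeats_lt {i q K : ℕ} {ω : Fin 3 → ℕ}
    (h : ∀ m, Repeats p i q m → m ≤ q) (hK : K ≤ weight ω p i q) : RepetitionBound ω K p i q := by
  intro m hm
  have := weight_mono ω p i (h m hm)
  omega

theorem three_le_weight (hp : IsImage innerMorphism p p) (h0 : p 0 = 0) (i : ℕ) {q : ℕ}
    (hq : 22 ≤ q) : 3 ≤ weight (letterWeight 1 0 0) p i q ∧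
      3 ≤ weight (letterWeight 0 1 0) p i q ∧ 3 ≤ weight (letterWeight 0 0 1) p i q := by
  obtain ⟨N, hN⟩ := (isImage_innerMorphismSq hp).exists_window_of_allImageSuffixes (by decide)
    (by decide) (window_four_mem_innerFactors hp h0) allImageSuffixes_checkCounts i
  simp only [checkCounts, List.all_cons, List.all_nil, Bool.and_eq_true, Nat.ble_eq,
    length_window] at hN
  obtain ⟨h22, h1, h2, h3, -⟩ := hN
  rw [takeWeight_window _ _ _ h22] at h1 h2 h3
  exact ⟨h1.trans (weight_mono _ _ _ hq), h2.trans (weight_mono _ _ _ hq),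
    h3.trans (weight_mono _ _ _ hq)⟩

theorem repetitionBound_of_mem_innerExceptions (hp : IsImage innerMorphism p p) (h0 : p 0 = 0)
    (i : ℕ) {q : ℕ} (hq : q ∈ innerExceptions) :
    ∀ B ∈ stableBounds, RepetitionBound B.1 B.2 p i q := by
  have hp4 : IsImage innerMorphismPowFour p p :=
    (isImage_innerMorphismSq hp).comp (isImage_innerMorphismSq hp)
  obtain ⟨N, hN⟩ := hp4.exists_window_of_allImageSuffixes (by decide) (by decide)
    (window_four_mem_innerFactors hp h0) allImageSuffixes_checkInnerExceptions i
  have h1 := List.all_eq_true.mp hN q hq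
  rw [Bool.and_eq_true, Bool.or_eq_true] at h1
  intro B hB
  rcases h1.2 with h2 | h2
  · rw [drop_window] at h2
    have h3 := mismatchWithin_sound N _ h2
    have hq22 : 22 ≤ q := by
      have : ∀ q ∈ innerExceptions, 22 ≤ q := by decide
      exact this q hq
    refine repetitionBound_of_repeats_lt (fun m hm => ?_) ?_
    · have := h3 m hm
      rw [weight_one] at this
      omega
    · have := three_le_weight hp h0 i hq22
      simp only [stableBounds, List.mem_cons, List.not_mem_nil, or_false] at hB
      rcases hB with rfl | rfl | rfl | rfl | rfl <;> simp only <;>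
        rw [weight_letterWeight] <;> omega
  · exact checkPeriod_sound (List.all_eq_true.mp h2 B hB)

theorem checkShortPeriods_window (hp : IsImage innerMorphism p p) (h0 : p 0 = 0) (i : ℕ) {q : ℕ}
    (hq : 0 < q) (hq22 : q < 22) :
    (weight (letterWeight 4 3 2) p i q ≤ 21 ∨
      weight (letterWeight 4 3 2) p i q ∈ innerExceptions ∨
      ∀ B ∈ preimageBounds, RepetitionBound B.1 B.2 p i q) ∧
    (weight (letterWeight 11 7 6) p i q ∈ outerExceptions ∨
      RepetitionBound (letterWeight 11 7 6) 24 p i q) := by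
  have hp3 : IsImage innerMorphismCube p p := (isImage_innerMorphismSq hp).comp hp
  obtain ⟨N, hN⟩ := hp3.exists_window_of_allImageSuffixes (by decide) (by decide)
    (window_four_mem_innerFactors hp h0) allImageSuffixes_checkShortPeriods i
  rw [checkShortPeriods, Bool.and_eq_true, Nat.ble_eq, length_window] at hN
  have h1 := List.all_eq_true.mp hN.2 q (List.mem_range.mpr hq22)
  simp only [takeWeight_window _ p i (hq22.le.trans hN.1), Bool.and_eq_true, Bool.or_eq_true,
    Nat.ble_eq, List.contains_iff_mem, beq_iff_eq, hq.ne', false_or, or_assoc] at h1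
  exact ⟨h1.1.imp_right fun h => h.imp_right fun h B hB =>
    checkPeriod_sound (List.all_eq_true.mp h B hB), h1.2.imp_right checkPeriod_sound⟩

/-- The bounds for all repetitions of the fixed point with period at least `22`. -/
theorem repetitionBound_stable (hp : IsImage innerMorphism p p) (h0 : p 0 = 0) {q : ℕ}
    (hq : 22 ≤ q) (i : ℕ) : ∀ B ∈ stableBounds, RepetitionBound B.1 B.2 p i q := by
  induction q using Nat.strong_induction_on generalizing i with
  | _ q ih =>
    by_cases hexc : q ∈ innerExceptions
    · exact repetitionBound_of_mem_innerExceptions hp h0 i hexc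
    suffices key : ∀ m, Repeats p i q m → ∀ B ∈ stableBounds,
        2 * weight B.1 p i m + B.2 ≤ 3 * weight B.1 p i q from fun B hB m hm => key m hm B hB
    intro m hm
    by_cases hm4 : 4 ≤ m
    · obtain ⟨i', q', m', hq', hr, hV, hW⟩ := isCoding_innerMorphism.exists_repeats hp
        (show 0 < q by omega) (m := m) (fun a => by
          have : ∀ a, (innerMorphism a).length ≤ 4 := by decide
          have := this a
          simp only [List.length_singleton]
          omega) hm
      have hlen := hV fun _ => 1
      rw [weight_one, sum_map_one_innerMorphism] at hlen
      have hpre : ∀ B ∈ preimageBounds, 2 * weight B.1 p i' m' + B.2 ≤ 3 * weight B.1 p i' q' := by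
        rcases Nat.lt_or_ge q' 22 with hlt | hge
        · rcases (checkShortPeriods_window hp h0 i' hq' hlt).1 with h | h | h
          · omega
          · rw [← hlen] at h
            exact absurd h hexc
          · exact fun B hB => h B hB m' hr
        · have hsum := weight_letterWeight_one (p := p) i' q'
          have hlt : q' < q := by
            rw [hlen]
            rw [weight_letterWeight] at hsum ⊢
            omega
          have hS := fun B hB => ih q' hlt hge i' B hB m' hr
          simp only [stableBounds, preimageBounds, List.forall_mem_cons, List.not_mem_nil,
            IsEmpty.forall_iff, implies_true, and_true] at hS ⊢
          simp only [weight_letterWeight 1 1 0, weight_letterWeight 1 1 1,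
            weight_letterWeight 2 1 1, weight_letterWeight 3 2 2,
            weight_letterWeight 4 3 2] at hS ⊢
          omega
      have hV0 := hV (letterWeight 1 0 0)
      have hV1 := hV (letterWeight 0 1 0)
      have hV2 := hV (letterWeight 0 0 1)
      have hW0 := hW (letterWeight 1 0 0)
      have hW1 := hW (letterWeight 0 1 0)
      have hW2 := hW (letterWeight 0 0 1)
      simp only [sum_map_innerMorphism, Nat.reduceMul, Nat.reduceAdd, weight_letterWeight 1 1 1,
        weight_letterWeight 2 1 1, weight_letterWeight 1 1 0] at hV0 hV1 hV2 hW0 hW1 hW2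
      simp only [stableBounds, preimageBounds, List.forall_mem_cons, List.not_mem_nil,
        IsEmpty.forall_iff, implies_true, and_true] at hpre ⊢
      simp only [weight_letterWeight 1 1 0, weight_letterWeight 1 1 1, weight_letterWeight 2 1 1,
        weight_letterWeight 3 2 2, weight_letterWeight 4 3 2] at hpre ⊢
      simp only [List.map_cons, List.map_nil, List.sum_cons, List.sum_nil, letterWeight]
        at hW0 hW1 hW2
      omega
    · have h3 := three_le_weight hp h0 i hq
      have hsum := weight_letterWeight_one (p := p) i m
      simp only [stableBounds, List.forall_mem_cons, List.not_mem_nil,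
        IsEmpty.forall_iff, implies_true, and_true]
      simp only [weight_letterWeight 1 1 0, weight_letterWeight 1 1 1] at hsum ⊢
      omega

/-- Every repetition in the binary word has exponent at most `5 / 2`. -/
theorem repetitionBound_outer (hp : IsImage innerMorphism p p) (h0 : p 0 = 0)
    (hw : IsImage outerMorphism p w) {i q m : ℕ} (hq : 0 < q) (hm : Repeats w i q m) :
    2 * m ≤ 3 * q := by
  by_cases hexc : q ∈ outerExceptions
  · obtain ⟨N, hN⟩ := ((isImage_innerMorphismSq hp).comp hw).exists_window_of_allImageSuffixes
      (by decide) (by decide) (window_four_mem_innerFactors hp h0)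
      allImageSuffixes_checkOuterExceptions i
    have := checkPeriod_sound (List.all_eq_true.mp hN q hexc) m hm
    simpa only [weight_one, Nat.add_zero] using this
  · have hq8 : 8 ≤ q := by
      by_contra! hlt
      interval_cases q <;> exact hexc (by decide)
    by_cases hm12 : 12 ≤ m
    · obtain ⟨i', q', m', hq', hr, hV, hW⟩ := isCoding_outerMorphism.exists_repeats hw
        (show 0 < q by omega) (m := m) (fun a => by
          have : ∀ a, (outerMorphism a).length ≤ 11 := by decide
          have := this a
          simp only [List.length_cons, List.length_nil]
          omega) hm
      have hV1 := hV fun _ => 1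
      have hW1 := hW fun _ => 1
      rw [weight_one, sum_map_one_outerMorphism] at hV1 hW1
      simp only [List.map_cons, List.map_nil, List.sum_cons, List.sum_nil] at hW1
      have hB : 2 * weight (letterWeight 11 7 6) p i' m' + 24 ≤
          3 * weight (letterWeight 11 7 6) p i' q' := by
        rcases Nat.lt_or_ge q' 22 with hlt | hge
        · rcases (checkShortPeriods_window hp h0 i' hq' hlt).2 with h | h
          · rw [← hV1] at h
            exact absurd h hexc
          · exact h m' hr
        · have hS := fun B hB => repetitionBound_stable hp h0 hge i' B hB m' hr
          simp only [stableBounds, List.forall_mem_cons, List.not_mem_nil,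
            IsEmpty.forall_iff, implies_true, and_true] at hS
          simp only [weight_letterWeight 11 7 6]
          omega
      omega
    · omega

/-- The factors of length `n ≤ 8` of the binary word. -/
def outerFactors (n : ℕ) : List (List Bool) :=
  innerFactors.flatMap fun X =>
    (List.range ((X.head?.map fun a => (outerMorphism a).length).getD 0)).map fun t =>
      ((X.flatMap outerMorphism).drop t).take n

theorem window_mem_outerFactors (hp : IsImage innerMorphism p p) (h0 : p 0 = 0)
    (hw : IsImage outerMorphism p w) (i : ℕ) {n : ℕ} (hn : n ≤ 8) :
    window w i n ∈ outerFactors n := by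
  obtain ⟨j, t, rfl, ht⟩ := exists_blockStart_add_eq isCoding_outerMorphism.ne_nil p i
  have hj := window_four_mem_innerFactors hp h0 j
  have hlen : ∀ X ∈ innerFactors, ∀ t < ((X.head?.map fun a => (outerMorphism a).length).getD 0),
      t + 8 ≤ (X.flatMap outerMorphism).length := by decide
  have ht' : t < (((window p j 4).head?.map fun a => (outerMorphism a).length).getD 0) := by
    simpa [window_cons] using ht
  have h8 := hlen _ hj t ht'
  refine List.mem_flatMap.mpr ⟨_, hj, List.mem_map.mpr ⟨t, List.mem_range.mpr ht', ?_⟩⟩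
  rw [hw.flatMap_window j 4, drop_window, take_window (by omega)]

/-- The nonempty factors of length at most `7` whose complements are factors. -/
def complementaryFactors : Finset (List Bool) :=
  ((List.range 8).flatMap fun n =>
    (outerFactors n).filter fun x => x ≠ [] ∧ comp x ∈ outerFactors n).toFinset

theorem card_complementaryFactors : complementaryFactors.card ≤ 36 := by decide +kernel

theorem comp_notMem_outerFactors : ∀ x ∈ outerFactors 8, comp x ∉ outerFactors 8 := by
  decide +kernel

theorem mem_complementaryFactors (hp : IsImage innerMorphism p p) (h0 : p 0 = 0)
    (hw : IsImage outerMorphism p w) {x : List Bool} (hx : x ≠ []) (h1 : FactorN w x)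
    (h2 : FactorN w (comp x)) : x ∈ complementaryFactors := by
  obtain ⟨i, hi⟩ := h1
  obtain ⟨j, hj⟩ := h2
  change x = window w i x.length at hi
  change comp x = window w j (comp x).length at hj
  have hc : (comp x).length = x.length := by simp [comp]
  rw [hc] at hj
  rcases Nat.lt_or_ge x.length 8 with hlt | hge
  · simp only [complementaryFactors, List.mem_toFinset, List.mem_flatMap, List.mem_range,
      List.mem_filter, decide_eq_true_eq]
    refine ⟨x.length, hlt, ?_, hx, ?_⟩
    · have := window_mem_outerFactors hp h0 hw i hlt.le
      rwa [← hi] at this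
    · have := window_mem_outerFactors hp h0 hw j hlt.le
      rwa [← hj] at this
  · refine absurd ?_ (comp_notMem_outerFactors _ (window_mem_outerFactors hp h0 hw i le_rfl))
    have e : comp (window w i 8) = window w j 8 := by
      rw [← take_window hge, ← take_window hge, ← hi, ← hj]
      simp [comp, List.map_take]
    rw [e]
    exact window_mem_outerFactors hp h0 hw j le_rfl

end TheWord

theorem expo_le_of_repeats {α : Type*} {w : ℕ → α}
    (h : ∀ i q m, 0 < q → Repeats w i q m → 2 * m ≤ 3 * q) {x : List α} (hx : FactorN w x)
    (hne : x ≠ []) : expo x ≤ (5 : ℝ) / 2 := by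
  obtain ⟨i, hi⟩ := hx
  change x = window w i x.length at hi
  have hget : ∀ k < x.length, x[k]? = some (w (i + k)) := fun k hk =>
    (congrArg (·[k]?) hi).trans (getElem?_window hk)
  have hmem : HasPeriod x (minPeriod x) :=
    Nat.sInf_mem (s := {p | HasPeriod x p})
      ⟨x.length, List.length_pos_iff.mpr hne, fun i hi => by omega⟩
  obtain ⟨hpos, hper⟩ := hmem
  have hrep : Repeats w i (minPeriod x) (x.length - minPeriod x) := by
    intro k hk
    have := hper k (by omega)
    rw [hget k (by omega), hget _ (by omega), Option.some_inj] at this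
    rw [this]
    congr 1
    omega
  have hb := h i _ _ hpos hrep
  have hnat : 2 * x.length ≤ 5 * minPeriod x := by omega
  have hreal : 2 * (x.length : ℝ) ≤ 5 * (minPeriod x : ℝ) := by exact_mod_cast hnat
  have hposR : (0 : ℝ) < (minPeriod x : ℝ) := by exact_mod_cast hpos
  rw [expo, div_le_iff₀ hposR]
  linarith

theorem stmt10 :
    ∃ w : ℕ → Bool,
      (∀ x : List Bool, FactorN w x → x ≠ [] → expo x ≤ (5 : ℝ) / 2) ∧
      ∃ F : Finset (List Bool), F.card ≤ 36 ∧
        ∀ x : List Bool, x ≠ [] → FactorN w x → FactorN w (comp x) → x ∈ F := by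
  obtain ⟨p, h0, hp⟩ := exists_isImage_self (f := innerMorphism) (by decide) 0 (by decide)
  obtain ⟨w, hw⟩ := exists_isImage isCoding_outerMorphism.ne_nil p
  exact ⟨w, fun x hx hne => expo_le_of_repeats
    (fun i q m hq hm => repetitionBound_outer hp h0 hw hq hm) hx hne,
    complementaryFactors, card_complementaryFactors,
    fun x hx h1 h2 => mem_complementaryFactors hp h0 hw hx h1 h2⟩
end
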